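/- arXiv:1606.08417 — 2 statements merged into one kernel-verified Lean document; each statement's English description precedes it below -/
import Mathlib

section
/- Let d ≥ 1 and let I : C²_b(ℝ^d) → C_b(ℝ^d) be Lipschitz with constant K₀, satisfy the global comparison property and the locality assumption, and in addition be convex, i.e. I(λu + (1−λ)v)(x) ≤ λ·I(u)(x) + (1−λ)·I(v)(x) for all u, v ∈ C²_b(ℝ^d), λ ∈ [0,1] and x ∈ ℝ^d. Then there exists a constant Λ (depending only on d and K₀) such that for every v ∈ C²_b(ℝ^d) and every x ∈ ℝ^d there is a Lévy-type functional L_{v,x} based at x, with |A| ≤ Λ, |B| ≤ Λ, |C| ≤ Λ and ∫ min(1,|y−x|²) dμ(y) ≤ Λ, satisfying I(u)(x) ≥ I(v)(x) + L_{v,x}(u − v) for all u ∈ C²_b(ℝ^d). Consequently, the min-max representation of I reduces to a max formula: for every u ∈ C²_b(ℝ^d) and x ∈ ℝ^d, I(u)(x) = sup over v ∈ C²_b(ℝ^d) of ( I(v)(x) + L_{v,x}(u − v) ), the supremum being attained at v = u. -/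
open MeasureTheory Metric Filter Set

noncomputable section

abbrev Euc (d : ℕ) := EuclideanSpace ℝ (Fin d)

variable {d : ℕ}

def supNorm (u : Euc d → ℝ) : ℝ := ⨆ x, |u x|

def gradSup (u : Euc d → ℝ) : ℝ := ⨆ x, ‖fderiv ℝ u x‖

def hessSup (u : Euc d → ℝ) : ℝ := ⨆ x, ‖iteratedFDeriv ℝ 2 u x‖

def C2Norm (u : Euc d → ℝ) : ℝ := supNorm u + gradSup u + hessSup u

def IsC2b (u : Euc d → ℝ) : Prop :=
  ContDiff ℝ 2 u ∧ ∃ M : ℝ, ∀ x, |u x| ≤ M ∧ ‖fderiv ℝ u x‖ ≤ M ∧ ‖iteratedFDeriv ℝ 2 u x‖ ≤ M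

def IsCb (f : Euc d → ℝ) : Prop := Continuous f ∧ ∃ M : ℝ, ∀ x, |f x| ≤ M

def GCP (dom : (Euc d → ℝ) → Prop) (I : (Euc d → ℝ) → Euc d → ℝ) : Prop :=
  ∀ u v, dom u → dom v → (∀ y, u y ≤ v y) → ∀ x, u x = v x → I u x ≤ I v x

def LipWith (K₀ : ℝ) (dom : (Euc d → ℝ) → Prop) (N : (Euc d → ℝ) → ℝ)
    (I : (Euc d → ℝ) → Euc d → ℝ) : Prop :=
  ∀ u v, dom u → dom v → ∀ x, |I u x - I v x| ≤ K₀ * N (fun y => u y - v y)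

def localSup (r : ℝ) (u : Euc d → ℝ) : ℝ := ⨆ x ∈ closedBall (0 : Euc d) r, |u x|

def localGradSup (r : ℝ) (u : Euc d → ℝ) : ℝ :=
  ⨆ x ∈ closedBall (0 : Euc d) r, ‖fderiv ℝ u x‖

def localHessSup (r : ℝ) (u : Euc d → ℝ) : ℝ :=
  ⨆ x ∈ closedBall (0 : Euc d) r, ‖iteratedFDeriv ℝ 2 u x‖

def localC2Norm (r : ℝ) (u : Euc d → ℝ) : ℝ := localSup r u + localGradSup r u + localHessSup r u

def Locality (dom : (Euc d → ℝ) → Prop) (locN : ℝ → (Euc d → ℝ) → ℝ)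
    (I : (Euc d → ℝ) → Euc d → ℝ) : Prop :=
  ∃ C₀ : ℝ, ∃ ω : ℝ → ℝ, (∀ r > (0 : ℝ), 0 < ω r) ∧ Tendsto ω atTop (nhds 0) ∧
    ∃ r₀ : ℝ, ∀ r ≥ r₀, ∀ u v, dom u → dom v → ∀ x : Euc d, ‖x‖ ≤ r →
      |I u x - I v x| ≤ C₀ * locN (2 * r) (fun y => u y - v y)
        + C₀ * ω r * supNorm (fun y => u y - v y)

structure LevyData (d : ℕ) where
  base : Euc d
  A : Matrix (Fin d) (Fin d) ℝ
  B : Euc d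
  C : ℝ
  μ : Measure (Euc d)

def LevyData.apply (L : LevyData d) (u : Euc d → ℝ) : ℝ :=
  (∑ i, ∑ j, L.A i j *
      iteratedFDeriv ℝ 2 u L.base ![EuclideanSpace.single i (1:ℝ), EuclideanSpace.single j (1:ℝ)])
    + fderiv ℝ u L.base L.B + L.C * u L.base
    + ∫ y, (u y - u L.base -
        Set.indicator (ball L.base 1) (fun z => fderiv ℝ u L.base (z - L.base)) y) ∂L.μ

def LevyBounds (Λ : ℝ) (L : LevyData d) : Prop :=
  L.A.IsSymm ∧ L.A.PosSemidef ∧ (∀ i j, |L.A i j| ≤ Λ) ∧ ‖L.B‖ ≤ Λ ∧ |L.C| ≤ Λ ∧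
    L.μ {L.base} = 0 ∧
    (∫⁻ y, ENNReal.ofReal (min 1 (‖y - L.base‖ ^ 2)) ∂L.μ) ≤ ENNReal.ofReal Λ

/-- `I` is convex -/
def ConvexOp (dom : (Euc d → ℝ) → Prop) (I : (Euc d → ℝ) → Euc d → ℝ) : Prop :=
  ∀ u v, dom u → dom v → ∀ t : ℝ, t ∈ Set.Icc (0 : ℝ) 1 → ∀ x : Euc d,
    I (fun y => t * u y + (1 - t) * v y) x ≤ t * I u x + (1 - t) * I v x


/-- subgradient of a convex function on a real vector space -/
lemma exists_subgradient {V : Type*} [AddCommGroup V] [Module ℝ V] (F : V → ℝ)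
    (hF : ∀ u v : V, ∀ t ∈ Set.Icc (0:ℝ) 1, F (t • u + (1 - t) • v) ≤ t * F u + (1 - t) * F v) :
    ∃ l : V →ₗ[ℝ] ℝ, ∀ h, F 0 + l h ≤ F h := by
  let q : V → ℝ → ℝ := fun h t => (F (t • h) - F 0) / t
  have hbd : ∀ h, ∀ t > 0, -(F (-h) - F 0) ≤ q h t := by
    intro h t ht
    have h1 := hF (t • h) (-h) (1 / (1 + t)) ⟨by positivity, by rw [div_le_one (by positivity)]; linarith⟩
    have e : (1 / (1 + t)) • t • h + (1 - 1 / (1 + t)) • (-h) = 0 := by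
      rw [smul_neg, smul_smul, ← sub_eq_add_neg, ← sub_smul]
      have : 1 / (1 + t) * t - (1 - 1 / (1 + t)) = 0 := by field_simp; ring
      rw [this, zero_smul]
    rw [e] at h1
    have h2 : (1 + t) * F 0 ≤ F (t • h) + t * F (-h) := by
      have := mul_le_mul_of_nonneg_left h1 (by positivity : 0 ≤ 1 + t)
      have e2 : (1 + t) * (1 / (1 + t) * F (t • h) + (1 - 1 / (1 + t)) * F (-h))
        = F (t • h) + t * F (-h) := by field_simp; ring
      linarith
    simp only [q]
    rw [le_div_iff₀ ht]
    nlinarith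
  let p : V → ℝ := fun h => ⨅ t : Set.Ioi (0:ℝ), q h t
  have hbdd : ∀ h, BddBelow (Set.range fun t : Set.Ioi (0:ℝ) => q h t) := fun h =>
    ⟨_, by rintro _ ⟨t, rfl⟩; exact hbd h t t.2⟩
  have hple : ∀ h, ∀ t > 0, p h ≤ q h t := fun h t ht => ciInf_le (hbdd h) ⟨t, ht⟩
  have : Nonempty (Set.Ioi (0:ℝ)) := ⟨⟨1, by simp⟩⟩
  have hlep : ∀ h c, (∀ t > 0, c ≤ q h t) → c ≤ p h := fun h c H => le_ciInf fun t => H t t.2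
  have hhom1 : ∀ c : ℝ, 0 < c → ∀ x, c * p x ≤ p (c • x) := by
    intro c hc x
    refine hlep _ _ fun t ht => ?_
    have h1 := hple x (t * c) (by positivity)
    have : q (c • x) t = c * q x (t * c) := by
      simp only [q, smul_smul]; field_simp
    rw [this]
    exact mul_le_mul_of_nonneg_left h1 hc.le
  have hhom : ∀ c : ℝ, 0 < c → ∀ x, p (c • x) = c * p x := by
    intro c hc x
    refine le_antisymm ?_ (hhom1 c hc x)
    have := hhom1 c⁻¹ (by positivity) (c • x)
    rw [smul_smul, inv_mul_cancel₀ hc.ne', one_smul, inv_mul_le_iff₀ hc] at this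
    exact this
  have hadd : ∀ x y, p (x + y) ≤ p x + p y := by
    intro x y
    have key : ∀ s > 0, ∀ t > 0, p (x + y) ≤ q x s + q y t := by
      intro s hs t ht
      have h1 := hple (x + y) (s * t / (s + t)) (by positivity)
      have h2 := hF (s • x) (t • y) (t / (s + t))
        ⟨by positivity, by rw [div_le_one (by positivity)]; linarith⟩
      have e : (t / (s + t)) • s • x + (1 - t / (s + t)) • t • y = (s * t / (s + t)) • (x + y) := by
        rw [smul_smul, smul_smul, smul_add]
        congr 2
        · field_simp
        · field_simp; ring
      rw [e] at h2
      refine h1.trans ?_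
      simp only [q]
      rw [div_le_iff₀ (by positivity)]
      have e2 : ((F (s • x) - F 0) / s + (F (t • y) - F 0) / t) * (s * t / (s + t))
        = t / (s + t) * F (s • x) + (1 - t / (s + t)) * F (t • y) - F 0 := by
        field_simp; ring
      rw [e2]; linarith
    have h1 : ∀ s > 0, p (x + y) - q x s ≤ p y := fun s hs =>
      hlep _ _ fun t ht => by linarith [key s hs t ht]
    have h2 : p (x + y) - p y ≤ p x := hlep _ _ fun s hs => by linarith [h1 s hs]
    linarith
  have hp0 : p 0 = 0 := by
    have := hhom 2 (by norm_num) 0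
    rw [smul_zero] at this; linarith
  obtain ⟨l, -, hl⟩ := exists_extension_of_le_sublinear
    (⟨⊥, 0⟩ : V →ₗ.[ℝ] ℝ) p hhom hadd (by
      rintro ⟨x, hx⟩
      have : x = 0 := by simpa using hx
      subst this
      simp [hp0])
  refine ⟨l, fun h => ?_⟩
  have := (hl h).trans (hple h 1 one_pos)
  simp only [q, one_smul, div_one] at this
  linarith

/-- the space of C2b functions -/
def C2bSub (d : ℕ) : Submodule ℝ (Euc d → ℝ) where
  carrier := {u | IsC2b u}
  zero_mem' := by
    refine ⟨contDiff_const, 0, fun x => ?_⟩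
    have h0 : (0 : Euc d → ℝ) = fun _ => (0:ℝ) := rfl
    simp [h0]
  add_mem' := by
    rintro u v ⟨hu, M, hM⟩ ⟨hv, N, hN⟩
    refine ⟨hu.add hv, M + N, fun x => ⟨?_, ?_, ?_⟩⟩
    · exact (abs_add_le _ _).trans (add_le_add (hM x).1 (hN x).1)
    · rw [fderiv_add (hu.differentiable (by norm_num) x) (hv.differentiable (by norm_num) x)]
      exact (norm_add_le _ _).trans (add_le_add (hM x).2.1 (hN x).2.1)
    · rw [iteratedFDeriv_add_apply hu.contDiffAt hv.contDiffAt]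
      exact (norm_add_le _ _).trans (add_le_add (hM x).2.2 (hN x).2.2)
  smul_mem' := by
    rintro c u ⟨hu, M, hM⟩
    refine ⟨contDiff_const.smul hu, |c| * M, fun x => ⟨?_, ?_, ?_⟩⟩
    · simp only [Pi.smul_apply, smul_eq_mul, abs_mul]
      exact mul_le_mul_of_nonneg_left (hM x).1 (abs_nonneg c)
    · rw [fderiv_const_smul (hu.differentiable (by norm_num) x), norm_smul]
      exact mul_le_mul_of_nonneg_left (hM x).2.1 (abs_nonneg c)
    · rw [iteratedFDeriv_const_smul_apply hu.contDiffAt, norm_smul]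
      exact mul_le_mul_of_nonneg_left (hM x).2.2 (abs_nonneg c)

lemma mem_C2bSub {u : Euc d → ℝ} : u ∈ C2bSub d ↔ IsC2b u := Iff.rfl

lemma isC2b_const (c : ℝ) : IsC2b (fun _ : Euc d => c) := by
  refine ⟨contDiff_const, |c|, fun x => ?_⟩
  have : iteratedFDeriv ℝ 2 (fun _ : Euc d => c) x = 0 := by
    rw [iteratedFDeriv_const_of_ne (by norm_num)]; rfl
  simp [this]

lemma isC2b_of_compact {u : Euc d → ℝ} (hu : ContDiff ℝ 2 u) (hc : HasCompactSupport u) :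
    IsC2b u := by
  obtain ⟨M1, h1⟩ := hu.continuous.bounded_above_of_compact_support hc
  obtain ⟨M2, h2⟩ := (hu.continuous_fderiv (by norm_num)).bounded_above_of_compact_support
    (hc.fderiv ℝ)
  obtain ⟨M3, h3⟩ := (hu.continuous_iteratedFDeriv (m := 2) (by norm_num)).bounded_above_of_compact_support
    (hc.iteratedFDeriv 2)
  refine ⟨hu, max M1 (max M2 M3), fun x => ⟨?_, ?_, ?_⟩⟩
  · exact (h1 x).trans (le_max_left _ _)
  · exact (h2 x).trans ((le_max_left _ _).trans (le_max_right _ _))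
  · exact (h3 x).trans ((le_max_right _ _).trans (le_max_right _ _))

lemma IsC2b.comp_sub {u : Euc d → ℝ} (hu : IsC2b u) (a : Euc d) : IsC2b (fun y => u (y - a)) := by
  obtain ⟨h1, M, hM⟩ := hu
  refine ⟨h1.comp (contDiff_id.sub contDiff_const), M, fun x => ⟨(hM _).1, ?_, ?_⟩⟩
  · rw [fderiv_comp_sub]; exact (hM _).2.1
  · rw [iteratedFDeriv_comp_sub]; exact (hM _).2.2

lemma C2Norm_comp_sub (u : Euc d → ℝ) (a : Euc d) : C2Norm (fun y => u (y - a)) = C2Norm u := by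
  unfold C2Norm supNorm gradSup hessSup
  congr 1
  · congr 1
    · exact (Equiv.subRight a).iSup_comp (g := fun x => |u x|)
    · simp_rw [fderiv_comp_sub]
      exact (Equiv.subRight a).iSup_comp (g := fun x => ‖fderiv ℝ u x‖)
  · simp_rw [iteratedFDeriv_comp_sub]
    exact (Equiv.subRight a).iSup_comp (g := fun x => ‖iteratedFDeriv ℝ 2 u x‖)

lemma C2Norm_nonneg (u : Euc d → ℝ) : 0 ≤ C2Norm u := by
  unfold C2Norm supNorm gradSup hessSup
  have h1 : 0 ≤ ⨆ x, |u x| := Real.iSup_nonneg fun _ => abs_nonneg _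
  have h2 : 0 ≤ ⨆ x, ‖fderiv ℝ u x‖ := Real.iSup_nonneg fun _ => norm_nonneg _
  have h3 : 0 ≤ ⨆ x, ‖iteratedFDeriv ℝ 2 u x‖ := Real.iSup_nonneg fun _ => norm_nonneg _
  linarith

lemma C2Norm_neg (u : Euc d → ℝ) : C2Norm (-u) = C2Norm u := by
  unfold C2Norm supNorm gradSup hessSup
  congr 1
  · congr 1
    · simp
    · congr 1; ext x; rw [fderiv_neg, norm_neg]
  · congr 1; ext x; rw [iteratedFDeriv_neg_apply, norm_neg]

/-- second order Taylor expansion with little-o remainder -/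
lemma taylor_two {h : Euc d → ℝ} (hh : ContDiff ℝ 2 h) {ε : ℝ} (hε : 0 < ε) :
    ∃ δ > 0, ∀ z : Euc d, ‖z‖ < δ → |h z - h 0 - fderiv ℝ h 0 z
      - (1/2) * fderiv ℝ (fderiv ℝ h) 0 z z| ≤ ε * ‖z‖ ^ 2 := by
  have hd1 : Differentiable ℝ h := hh.differentiable (by norm_num)
  have hd2 : Differentiable ℝ (fderiv ℝ h) :=
    (hh.fderiv_right (m := 1) (by norm_num)).differentiable (by norm_num)
  have hs : IsSymmSndFDerivAt ℝ h 0 := hh.contDiffAt.isSymmSndFDerivAt (by simp)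
  set H := fderiv ℝ (fderiv ℝ h) 0 with hH
  have h1 := (hd2 0).hasFDerivAt.isLittleO
  rw [Asymptotics.isLittleO_iff] at h1
  have h2 := h1 hε
  rw [Metric.eventually_nhds_iff] at h2
  obtain ⟨δ, hδ, h2⟩ := h2
  refine ⟨δ, hδ, fun z hz => ?_⟩
  let P : Euc d → ℝ := fun z => h z - h 0 - fderiv ℝ h 0 z - (1/2) * H z z
  let P' : Euc d → Euc d →L[ℝ] ℝ := fun z => fderiv ℝ h z - fderiv ℝ h 0 - H z
  have hP : ∀ y, HasFDerivAt P (P' y) y := by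
    intro y
    have a1 := (hd1 y).hasFDerivAt
    have a2 := (fderiv ℝ h 0).hasFDerivAt (x := y)
    have a3 : HasFDerivAt (fun z => H z z) _ y := H.hasFDerivAt.clm_apply (hasFDerivAt_id y)
    have := ((a1.sub_const (h 0)).sub a2).sub (a3.const_mul (1/2))
    refine this.congr_fderiv ?_
    ext w
    have := hs y w
    simp [P'] at this ⊢
    rw [← hH] at this
    rw [this]; ring
  have hb : ∀ y ∈ closedBall (0 : Euc d) ‖z‖, ‖P' y‖ ≤ ε * ‖z‖ := by
    intro y hy
    rw [mem_closedBall, dist_zero_right] at hy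
    have := h2 (y := y) (by rw [dist_zero_right]; linarith)
    simp only [sub_zero] at this
    exact this.trans (mul_le_mul_of_nonneg_left hy hε.le)
  have := (convex_closedBall (0 : Euc d) ‖z‖).norm_image_sub_le_of_norm_hasFDerivWithin_le
    (fun y _ => (hP y).hasFDerivWithinAt) hb (mem_closedBall_self (norm_nonneg z))
    (show z ∈ closedBall (0 : Euc d) ‖z‖ by simp)
  have hP0 : P 0 = 0 := by simp [P]
  rw [hP0, sub_zero, sub_zero, Real.norm_eq_abs] at this
  rw [pow_two, ← mul_assoc]
  exact this

/-- the space of bounded functions -/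
def BddSub (d : ℕ) : Submodule ℝ (Euc d → ℝ) where
  carrier := {u | ∃ M : ℝ, ∀ x, |u x| ≤ M}
  zero_mem' := ⟨0, by simp⟩
  add_mem' := by
    rintro u v ⟨M, hM⟩ ⟨N, hN⟩
    exact ⟨M + N, fun x => (abs_add_le _ _).trans (add_le_add (hM x) (hN x))⟩
  smul_mem' := by
    rintro c u ⟨M, hM⟩
    refine ⟨|c| * M, fun x => ?_⟩
    simp only [Pi.smul_apply, smul_eq_mul, abs_mul]
    exact mul_le_mul_of_nonneg_left (hM x) (abs_nonneg c)

/-- extension of a functional with the GCP at the origin -/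
lemma exists_ext (l : C2bSub d →ₗ[ℝ] ℝ) (hl : ∀ h : C2bSub d, (∀ y, 0 ≤ h.1 y) → h.1 0 = 0 → 0 ≤ l h)
    (ρ : Euc d → ℝ) (hρ : IsC2b ρ) (hρ0 : ρ 0 = 0) (hρpos : ∀ y, 0 ≤ ρ y) :
    ∃ T : BddSub d →ₗ[ℝ] ℝ, (∀ φ : BddSub d, (∀ y, 0 ≤ φ.1 y) → 0 ≤ T φ) ∧
      ∀ (φ : BddSub d) (h : C2bSub d), (∀ y, h.1 y = ρ y * φ.1 y) → T φ = l h := by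
  let m : BddSub d →ₗ[ℝ] (Euc d → ℝ) := (LinearMap.mulLeft ℝ ρ).comp (BddSub d).subtype
  let D : Submodule ℝ (BddSub d) := (C2bSub d).comap m
  let f : BddSub d →ₗ.[ℝ] ℝ := ⟨D, l.comp ((m.comp D.subtype).codRestrict (C2bSub d) (fun x => x.2))⟩
  let s : PointedCone ℝ (BddSub d) :=
    { carrier := {φ | ∀ y, 0 ≤ φ.1 y}
      zero_mem' := fun y => le_refl _
      add_mem' := fun ha hb y => add_nonneg (ha y) (hb y)
      smul_mem' := fun c φ hφ y => mul_nonneg c.2 (hφ y) }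
  obtain ⟨T, hT1, hT2⟩ := riesz_extension s f (by
    rintro ⟨φ, hφ⟩ hs
    refine hl _ (fun y => mul_nonneg (hρpos y) (hs y)) ?_
    change ρ 0 * φ.1 0 = 0
    rw [hρ0, zero_mul]) (by
    rintro ⟨φ, M, hM⟩
    refine ⟨⟨⟨fun _ => M, |M|, fun _ => le_rfl⟩, ?_⟩, fun y => ?_⟩
    · have : (ρ * fun _ => M) = M • ρ := by ext y; simp [mul_comm]
      change IsC2b (ρ * fun _ => M)
      rw [this]
      exact (C2bSub d).smul_mem M hρ
    · have := (abs_le.1 (hM y)).1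
      simp only [Submodule.coe_add, Pi.add_apply]
      linarith)
  refine ⟨T, hT2, fun φ h hh => ?_⟩
  have hm : m φ = h.1 := by ext y; simp [m, hh]
  have hD : φ ∈ D := by change m φ ∈ C2bSub d; rw [hm]; exact h.2
  refine (hT1 ⟨φ, hD⟩).trans ?_
  change l _ = l h
  congr 1
  exact Subtype.ext hm

lemma BddSub_mono {T : BddSub d →ₗ[ℝ] ℝ} (hT : ∀ φ : BddSub d, (∀ y, 0 ≤ φ.1 y) → 0 ≤ T φ)
    {a b : BddSub d} (h : ∀ y, a.1 y ≤ b.1 y) : T a ≤ T b := by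
  have := hT (b - a) (fun y => by simpa using h y)
  rw [map_sub] at this
  linarith

/-- a bump at scale `n` -/
def bumpN (d : ℕ) (n : ℕ) : ContDiffBump (0 : Euc d) :=
  ⟨n + 1, n + 2, by positivity, by linarith⟩

lemma bumpN_abs (n : ℕ) (y : Euc d) : |bumpN d n y| ≤ 1 := by
  rw [abs_of_nonneg (bumpN d n).nonneg]; exact (bumpN d n).le_one

open CompactlySupported in
/-- Riesz representation of tight positive functionals -/
lemma tight_riesz (T : BddSub d →ₗ[ℝ] ℝ) (hT : ∀ φ : BddSub d, (∀ y, 0 ≤ φ.1 y) → 0 ≤ T φ)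
    (one : BddSub d) (hone : ∀ y, one.1 y = 1)
    (ht : ∀ ε > 0, ∃ R : ℝ, ∀ φ : BddSub d, (∀ y, 0 ≤ φ.1 y) → (∀ y, φ.1 y ≤ 1) →
      (∀ y, ‖y‖ < R → φ.1 y = 0) → T φ ≤ ε) :
    ∃ ν : Measure (Euc d), ν univ ≤ ENNReal.ofReal (T one) ∧
      ∀ φ : BddSub d, Continuous φ.1 → T φ = ∫ y, φ.1 y ∂ν := by
  have hcb : ∀ f : C_c(Euc d, ℝ), (f : Euc d → ℝ) ∈ BddSub d := fun f =>
    f.continuous.bounded_above_of_compact_support f.hasCompactSupport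
  let S : C_c(Euc d, ℝ) →ₗ[ℝ] ℝ :=
    { toFun := fun f => T ⟨f, hcb f⟩
      map_add' := fun f g => by rw [← map_add]; rfl
      map_smul' := fun c f => by rw [RingHom.id_apply, ← map_smul]; rfl }
  let L : C_c(Euc d, ℝ) →ₚ[ℝ] ℝ := PositiveLinearMap.mk₀ S (fun f hf => hT _ (fun y => hf y))
  let ν := RealRMK.rieszMeasure L
  have hL : ∀ f : C_c(Euc d, ℝ), ∫ y, f y ∂ν = T ⟨f, hcb f⟩ := fun f =>
    RealRMK.integral_rieszMeasure L f
  have hball : ∀ n : ℕ, ν (closedBall 0 n) ≤ ENNReal.ofReal (T one) := by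
    intro n
    let f : C_c(Euc d, ℝ) := ⟨⟨bumpN d n, (bumpN d n).continuous⟩, (bumpN d n).hasCompactSupport⟩
    refine (RealRMK.rieszMeasure_le_of_eq_one L (f := f) (fun x => (bumpN d n).nonneg)
      (isCompact_closedBall _ _) (fun x hx => ?_)).trans ?_
    · refine (bumpN d n).one_of_mem_closedBall (closedBall_subset_closedBall ?_ hx)
      simp [bumpN]
    · refine ENNReal.ofReal_le_ofReal (BddSub_mono hT fun y => ?_)
      rw [hone]; exact (bumpN d n).le_one
  have huniv : ν univ ≤ ENNReal.ofReal (T one) := by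
    rw [← iUnion_closedBall_nat (0 : Euc d), Monotone.measure_iUnion]
    · exact iSup_le hball
    · intro a b hab
      exact closedBall_subset_closedBall (by exact_mod_cast hab)
  refine ⟨ν, huniv, fun φ hφ => ?_⟩
  have : IsFiniteMeasure ν := ⟨huniv.trans_lt ENNReal.ofReal_lt_top⟩
  obtain ⟨M, hM⟩ := φ.2
  have hM0 : 0 ≤ M := (abs_nonneg _).trans (hM 0)
  let g : ℕ → C_c(Euc d, ℝ) := fun n => ⟨⟨fun y => bumpN d n y * φ.1 y,
    (bumpN d n).continuous.mul hφ⟩, (bumpN d n).hasCompactSupport.mul_right⟩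
  have hlim1 : Tendsto (fun n => ∫ y, g n y ∂ν) atTop (nhds (∫ y, φ.1 y ∂ν)) := by
    refine tendsto_integral_of_dominated_convergence (fun _ => M)
      (fun n => (g n).continuous.aestronglyMeasurable) (integrable_const _) (fun n => ?_) ?_
    · refine Eventually.of_forall fun y => ?_
      change |bumpN d n y * φ.1 y| ≤ M
      rw [abs_mul]
      calc _ ≤ 1 * M := mul_le_mul (bumpN_abs n y) (hM y) (abs_nonneg _) zero_le_one
        _ = M := one_mul M
    · refine Eventually.of_forall fun y => ?_
      refine tendsto_const_nhds.congr' ?_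
      obtain ⟨N, hN⟩ := exists_nat_ge ‖y‖
      filter_upwards [eventually_ge_atTop N] with n hn
      have : bumpN d n y = 1 := by
        refine (bumpN d n).one_of_mem_closedBall ?_
        have : (N:ℝ) ≤ n := by exact_mod_cast hn
        simp [bumpN]; linarith
      change _ = bumpN d n y * φ.1 y
      rw [this, one_mul]
  have hlim2 : Tendsto (fun n => ∫ y, g n y ∂ν) atTop (nhds (T φ)) := by
    rw [Metric.tendsto_atTop]
    intro ε hε
    obtain ⟨R, hR⟩ := ht (ε / (2 * (M + 1))) (by positivity)
    obtain ⟨N, hN⟩ := exists_nat_ge R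
    refine ⟨N, fun n hn => ?_⟩
    have hn' : (N:ℝ) ≤ n := by exact_mod_cast hn
    rw [hL]
    let ψ : BddSub d := ⟨fun y => 1 - bumpN d n y, 1, fun y => by
      rw [abs_of_nonneg (sub_nonneg.2 (bumpN d n).le_one)]
      linarith [(bumpN d n).nonneg (x := y)]⟩
    have hψ := hR ψ (fun y => sub_nonneg.2 (bumpN d n).le_one)
      (fun y => by change 1 - bumpN d n y ≤ 1; linarith [(bumpN d n).nonneg (x := y)])
      (fun y hy => by
        have : bumpN d n y = 1 := by
          refine (bumpN d n).one_of_mem_closedBall ?_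
          simp [bumpN]; linarith
        simp [ψ, this])
    have key : ∀ y, |(φ.1 y - g n y)| ≤ M * ψ.1 y := by
      intro y
      have : φ.1 y - g n y = φ.1 y * ψ.1 y := by
        change φ.1 y - bumpN d n y * φ.1 y = φ.1 y * (1 - bumpN d n y); ring
      rw [this, abs_mul, abs_of_nonneg (a := ψ.1 y) (sub_nonneg.2 (bumpN d n).le_one)]
      exact mul_le_mul_of_nonneg_right (hM y) (sub_nonneg.2 (bumpN d n).le_one)
    have k1 := BddSub_mono hT (a := φ - ⟨g n, hcb _⟩) (b := M • ψ) (fun y => (abs_le.1 (key y)).2)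
    have k2 := BddSub_mono hT (a := -(M • ψ)) (b := φ - ⟨g n, hcb _⟩)  (fun y => (abs_le.1 (key y)).1)
    rw [map_neg] at k2
    rw [map_sub, map_smul, smul_eq_mul] at k1 k2
    have k3 : M * T ψ ≤ M * (ε / (2 * (M + 1))) := mul_le_mul_of_nonneg_left hψ hM0
    have k4 : M * (ε / (2 * (M + 1))) < ε := by
      rw [← mul_div_assoc, div_lt_iff₀ (by positivity)]
      nlinarith
    rw [Real.dist_eq, abs_lt]
    constructor <;> linarith
  exact tendsto_nhds_unique hlim2 hlim1

/-- regularised `min 1 |y|^2` -/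
def rhoF (d : ℕ) (y : Euc d) : ℝ := 1 + (‖y‖ ^ 2 - 1) * bumpN d 0 y
/-- truncated coordinate -/
def linF (i : Fin d) (y : Euc d) : ℝ := y i * bumpN d 0 y
/-- truncated quadratic monomial -/
def quadF (i j : Fin d) (y : Euc d) : ℝ := y i * y j * bumpN d 0 y

lemma coord_contDiff (i : Fin d) : ContDiff ℝ 2 (fun y : Euc d => y i) :=
  (EuclideanSpace.proj (𝕜 := ℝ) i).contDiff

lemma rhoF_C2b : IsC2b (rhoF d) := by
  refine (C2bSub d).add_mem (isC2b_const 1) (isC2b_of_compact ?_ ?_)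
  · exact (((contDiff_norm_sq ℝ).sub contDiff_const).mul (bumpN d 0).contDiff)
  · exact (bumpN d 0).hasCompactSupport.mul_left

lemma linF_C2b (i : Fin d) : IsC2b (linF i) :=
  isC2b_of_compact ((coord_contDiff i).mul (bumpN d 0).contDiff)
    (bumpN d 0).hasCompactSupport.mul_left

lemma quadF_C2b (i j : Fin d) : IsC2b (quadF i j) :=
  isC2b_of_compact (((coord_contDiff i).mul (coord_contDiff j)).mul (bumpN d 0).contDiff)
    (bumpN d 0).hasCompactSupport.mul_left

lemma eta_nonneg (y : Euc d) : 0 ≤ bumpN d 0 y := (bumpN d 0).nonneg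
lemma eta_le_one (y : Euc d) : bumpN d 0 y ≤ 1 := (bumpN d 0).le_one
lemma eta_one {y : Euc d} (hy : ‖y‖ ≤ 1) : bumpN d 0 y = 1 :=
  (bumpN d 0).one_of_mem_closedBall (by simpa [bumpN] using hy)
lemma eta_zero {y : Euc d} (hy : 2 ≤ ‖y‖) : bumpN d 0 y = 0 :=
  (bumpN d 0).zero_of_le_dist (by simpa [bumpN] using hy)

lemma rhoF_small {y : Euc d} (hy : ‖y‖ ≤ 1) : rhoF d y = ‖y‖ ^ 2 := by
  rw [rhoF, eta_one hy]; ring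

lemma rhoF_zero : rhoF d 0 = 0 := by rw [rhoF_small (by simp)]; simp

lemma rhoF_big {y : Euc d} (hy : 1 ≤ ‖y‖) : 1 ≤ rhoF d y := by
  have : 0 ≤ (‖y‖ ^ 2 - 1) * bumpN d 0 y := mul_nonneg (by nlinarith) (eta_nonneg y)
  rw [rhoF]; linarith

lemma rhoF_far {y : Euc d} (hy : 2 ≤ ‖y‖) : rhoF d y = 1 := by
  rw [rhoF, eta_zero hy]; ring

lemma min_le_rhoF (y : Euc d) : min 1 (‖y‖ ^ 2) ≤ rhoF d y := by
  rcases le_total ‖y‖ 1 with h | h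
  · rw [rhoF_small h]; exact min_le_right _ _
  · exact (min_le_left _ _).trans (rhoF_big h)

lemma rhoF_nonneg (y : Euc d) : 0 ≤ rhoF d y :=
  le_trans (le_min zero_le_one (by positivity)) (min_le_rhoF y)

lemma rhoF_pos {y : Euc d} (hy : y ≠ 0) : 0 < rhoF d y :=
  lt_of_lt_of_le (lt_min one_pos (by have := norm_pos_iff.2 hy; positivity)) (min_le_rhoF y)

lemma sq_eta_le (y : Euc d) : ‖y‖ ^ 2 * bumpN d 0 y ≤ rhoF d y := by
  rw [rhoF]; nlinarith [eta_le_one y]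

lemma coord_le (y : Euc d) (i : Fin d) : |y i| ≤ ‖y‖ := by
  simpa using PiLp.norm_apply_le y i

lemma quadF_le (i j : Fin d) (y : Euc d) : |quadF i j y| ≤ rhoF d y := by
  refine le_trans ?_ (sq_eta_le y)
  rw [quadF, abs_mul, abs_mul, abs_of_nonneg (eta_nonneg y), pow_two]
  exact mul_le_mul_of_nonneg_right
    (mul_le_mul (coord_le y i) (coord_le y j) (abs_nonneg _) (norm_nonneg _)) (eta_nonneg y)

/-- the drift correction -/
def corrF (i : Fin d) (y : Euc d) : ℝ :=
  y i * (Set.indicator (ball (0 : Euc d) 1) (fun _ => (1:ℝ)) y - bumpN d 0 y)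

lemma corrF_le (i : Fin d) (y : Euc d) : |corrF i y| ≤ 2 * rhoF d y := by
  rw [corrF]
  by_cases hy : ‖y‖ < 1
  · rw [Set.indicator_of_mem (by simpa using hy), eta_one hy.le]
    simpa using rhoF_nonneg y
  · rw [Set.indicator_of_notMem (by simpa using hy)]
    push Not at hy
    have h1 := rhoF_big hy
    rw [abs_mul, zero_sub, abs_neg, abs_of_nonneg (eta_nonneg y)]
    rcases le_total 2 ‖y‖ with h | h
    · rw [eta_zero h, mul_zero]; linarith
    · calc |y i| * bumpN d 0 y ≤ 2 * 1 :=
          mul_le_mul ((coord_le y i).trans h) (eta_le_one y) (eta_nonneg y) (by norm_num)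
        _ ≤ _ := by linarith

lemma corrF_meas (i : Fin d) : Measurable (corrF i) := by
  refine (coord_contDiff i).continuous.measurable.mul (Measurable.sub ?_ (bumpN d 0).continuous.measurable)
  exact measurable_const.indicator measurableSet_ball

lemma rhoF_cont : Continuous (rhoF d) := rhoF_C2b.1.continuous

/-- the Levy measure -/
def muF (ν : Measure (Euc d)) : Measure (Euc d) :=
  (ν.restrict {0}ᶜ).withDensity (fun y => ((Real.toNNReal (1 / rhoF d y) : NNReal) : ENNReal))

lemma muF_zero (ν : Measure (Euc d)) : muF ν {0} = 0 := by
  rw [muF, withDensity_apply _ (measurableSet_singleton _), Measure.restrict_restrict (measurableSet_singleton _)]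
  simp

lemma muF_rep (ν : Measure (Euc d)) {K : ℝ} (hK : 0 ≤ K) (hν : ν univ ≤ ENNReal.ofReal K) {f : Euc d → ℝ} (hf : Measurable f)
    {M : ℝ} (hM0 : 0 ≤ M) (hM : ∀ y, |f y| ≤ M * rhoF d y) :
    Integrable f (muF ν) ∧ ∫ y, f y ∂(muF ν) = ∫ y, f y / rhoF d y ∂ν ∧
      |∫ y, f y ∂(muF ν)| ≤ M * K := by
  have : IsFiniteMeasure ν := ⟨hν.trans_lt ENNReal.ofReal_lt_top⟩
  have hmeas : Measurable (fun y => Real.toNNReal (1 / rhoF d y)) :=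
    (measurable_const.div rhoF_cont.measurable).real_toNNReal
  have hb : ∀ y, |f y / rhoF d y| ≤ M := by
    intro y
    by_cases hy : y = 0
    · subst hy; simpa [rhoF_zero] using hM0
    · rw [abs_div, abs_of_pos (rhoF_pos hy), div_le_iff₀ (rhoF_pos hy)]
      exact hM y
  have hi : Integrable (fun y => f y / rhoF d y) ν :=
    Integrable.of_bound (hf.div rhoF_cont.measurable).aestronglyMeasurable M
      (Eventually.of_forall hb)
  have hsm : ∀ y, (Real.toNNReal (1 / rhoF d y)) • f y = f y / rhoF d y := by
    intro y
    rw [NNReal.smul_def, Real.coe_toNNReal _ (div_nonneg zero_le_one (rhoF_nonneg y)), smul_eq_mul]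
    ring
  have h2 : ∫ y, f y ∂(muF ν) = ∫ y, f y / rhoF d y ∂ν := by
    rw [muF, integral_withDensity_eq_integral_smul hmeas]
    simp_rw [hsm]
    refine setIntegral_eq_integral_of_forall_compl_eq_zero fun y hy => ?_
    have : y = 0 := by simpa using hy
    subst this; simp [rhoF_zero]
  refine ⟨?_, h2, ?_⟩
  · rw [muF, integrable_withDensity_iff_integrable_smul hmeas]
    simp_rw [hsm]
    exact hi.restrict
  · rw [h2]
    have := norm_integral_le_of_norm_le_const (μ := ν) (f := fun y => f y / rhoF d y)
      (Eventually.of_forall hb)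
    rw [Real.norm_eq_abs] at this
    refine this.trans (mul_le_mul_of_nonneg_left ?_ hM0)
    exact ENNReal.toReal_le_of_le_ofReal hK hν

lemma div_rho_bound {f : Euc d → ℝ} {M : ℝ} (hM0 : 0 ≤ M) (hM : ∀ y, |f y| ≤ M * rhoF d y) (y : Euc d) :
    |f y / rhoF d y| ≤ M := by
  by_cases hy : y = 0
  · subst hy; simpa [rhoF_zero] using hM0
  · rw [abs_div, abs_of_pos (rhoF_pos hy), div_le_iff₀ (rhoF_pos hy)]
    exact hM y

lemma mul_div_rho {f : Euc d → ℝ} {M : ℝ} (hM : ∀ y, |f y| ≤ M * rhoF d y) (y : Euc d) :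
    f y = rhoF d y * (f y / rhoF d y) := by
  by_cases hy : y = 0
  · subst hy
    have := hM 0
    rw [rhoF_zero, mul_zero] at this
    rw [rhoF_zero, zero_mul]
    exact abs_nonpos_iff.1 this
  · rw [mul_div_cancel₀ _ (rhoF_pos hy).ne']

/-- the basic structure: a measure representing the functional on its `o(|y|^2)` part -/
lemma levy_core (l : C2bSub d →ₗ[ℝ] ℝ)
    (hl : ∀ h : C2bSub d, (∀ y, 0 ≤ h.1 y) → h.1 0 = 0 → 0 ≤ l h)
    (ht : ∀ ε > 0, ∃ R : ℝ, ∀ h : C2bSub d, (∀ y, 0 ≤ h.1 y) → (∀ y, h.1 y ≤ 1) →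
      (∀ y, ‖y‖ < R → h.1 y = 0) → l h ≤ ε) :
    ∃ ν : Measure (Euc d), ν univ ≤ ENNReal.ofReal (l ⟨rhoF d, rhoF_C2b⟩) ∧
      (∀ R : C2bSub d, (∀ ε > 0, ∃ δ > 0, ∀ z, ‖z‖ < δ → |R.1 z| ≤ ε * ‖z‖ ^ 2) →
        Integrable R.1 (muF ν) ∧ l R = ∫ y, R.1 y ∂(muF ν)) ∧
      (∀ q : C2bSub d, ∀ M : ℝ, 0 ≤ M → (∀ y, 0 ≤ q.1 y) → (∀ y, |q.1 y| ≤ M * rhoF d y) →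
        ∫ y, q.1 y ∂(muF ν) ≤ l q) := by
  obtain ⟨T, hT, hTl⟩ := exists_ext l hl (rhoF d) rhoF_C2b rhoF_zero rhoF_nonneg
  let one : BddSub d := ⟨fun _ => 1, 1, fun _ => by simp⟩
  have hT1 : T one = l ⟨rhoF d, rhoF_C2b⟩ := hTl _ _ (fun y => by simp [one])
  have hl0 : 0 ≤ l ⟨rhoF d, rhoF_C2b⟩ := hl _ rhoF_nonneg rhoF_zero
  obtain ⟨ν, hν, hrep⟩ := tight_riesz T hT one (fun _ => rfl) (by
    intro ε hε
    obtain ⟨R, hR⟩ := ht ε hε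
    obtain ⟨n, hn⟩ := exists_nat_ge (max R 1)
    have hn1 : R ≤ n := (le_max_left _ _).trans hn
    have hn2 : (1:ℝ) ≤ n := (le_max_right _ _).trans hn
    have hone : ∀ y : Euc d, ‖y‖ ≤ n + 1 → bumpN d n y = 1 := fun y hy =>
      (bumpN d n).one_of_mem_closedBall (by simpa [bumpN] using hy)
    refine ⟨n + 2, fun φ h0 h1 h2 => ?_⟩
    let ψ : BddSub d := ⟨fun y => 1 - bumpN d n y, 1, fun y => by
      rw [abs_of_nonneg (sub_nonneg.2 (bumpN d n).le_one)]
      linarith [(bumpN d n).nonneg (x := y)]⟩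
    let g : C2bSub d := ⟨fun y => 1 - bumpN d n y, (C2bSub d).sub_mem (isC2b_const 1)
      (isC2b_of_compact (bumpN d n).contDiff (bumpN d n).hasCompactSupport)⟩
    have e1 : T φ ≤ T ψ := BddSub_mono hT fun y => by
      rcases lt_or_ge ‖y‖ (n + 2) with h | h
      · rw [h2 y h]; exact sub_nonneg.2 (bumpN d n).le_one
      · have : bumpN d n y = 0 := (bumpN d n).zero_of_le_dist (by simpa [bumpN] using h)
        refine (h1 y).trans ?_
        simp [ψ, this]
    have e2 : T ψ = l g := hTl _ _ fun y => by
      change 1 - bumpN d n y = rhoF d y * (1 - bumpN d n y)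
      rcases le_total ‖y‖ (n + 1) with h | h
      · rw [hone y h]; ring
      · rw [rhoF_far (by linarith)]; ring
    rw [e2] at e1
    refine e1.trans (hR g (fun y => sub_nonneg.2 (bumpN d n).le_one) (fun y => ?_) (fun y hy => ?_))
    · change 1 - bumpN d n y ≤ 1
      linarith [(bumpN d n).nonneg (x := y)]
    · change 1 - bumpN d n y = 0
      rw [hone y (by linarith)]; ring)
  rw [hT1] at hν
  have hfin : IsFiniteMeasure ν := ⟨hν.trans_lt ENNReal.ofReal_lt_top⟩
  refine ⟨ν, hν, fun R hR => ?_, fun q M hM0 hq0 hqM => ?_⟩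
  · obtain ⟨hRc, N, hN⟩ := R.2
    have hN0 : 0 ≤ N := (abs_nonneg _).trans (hN 0).1
    obtain ⟨δ, hδ, h1⟩ := hR 1 one_pos
    let m := min 1 (min δ 1 ^ 2)
    have hm : 0 < m := by positivity
    let M := max 1 (N / m)
    have hM0 : 0 ≤ M := zero_le_one.trans (le_max_left _ _)
    have hM : ∀ y, |R.1 y| ≤ M * rhoF d y := by
      intro y
      rcases lt_or_ge ‖y‖ (min δ 1) with h | h
      · rw [rhoF_small (h.le.trans (min_le_right _ _))]
        refine (h1 y (h.trans_le (min_le_left _ _))).trans ?_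
        exact mul_le_mul_of_nonneg_right (le_max_left _ _) (by positivity)
      · have hmr : m ≤ rhoF d y := by
          refine le_trans ?_ (min_le_rhoF y)
          exact min_le_min le_rfl (pow_le_pow_left₀ (by positivity) h 2)
        calc |R.1 y| ≤ N := (hN y).1
          _ = N / m * m := by field_simp
          _ ≤ M * rhoF d y := mul_le_mul (le_max_right _ _) hmr hm.le hM0
    let φ : BddSub d := ⟨fun y => R.1 y / rhoF d y, M, div_rho_bound hM0 hM⟩
    have hφc : Continuous φ.1 := by
      rw [continuous_iff_continuousAt]
      intro y
      by_cases hy : y = 0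
      · subst hy
        rw [Metric.continuousAt_iff]
        intro ε hε
        obtain ⟨δ', hδ', h2⟩ := hR (ε / 2) (by positivity)
        refine ⟨min δ' 1, by positivity, fun {z} hz => ?_⟩
        rw [dist_zero_right] at hz
        have hz1 := hz.trans_le (min_le_left _ _)
        have hz2 := hz.trans_le (min_le_right _ _)
        have e0 : φ.1 0 = 0 := by simp [φ, rhoF_zero]
        rw [e0, Real.dist_eq, sub_zero]
        by_cases hz0 : z = 0
        · subst hz0; rw [e0]; simpa using hε
        · have hp := rhoF_pos hz0
          have : |φ.1 z| ≤ ε / 2 := by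
            change |R.1 z / rhoF d z| ≤ ε / 2
            rw [abs_div, abs_of_pos hp, div_le_iff₀ hp, rhoF_small hz2.le]
            exact h2 z hz1
          linarith
      · exact (hRc.continuous.continuousAt).div rhoF_cont.continuousAt (rhoF_pos hy).ne'
    obtain ⟨k1, k2, -⟩ := muF_rep ν hl0 hν hRc.continuous.measurable hM0 hM
    refine ⟨k1, ?_⟩
    rw [k2, ← hrep φ hφc]
    exact (hTl φ R (mul_div_rho hM)).symm
  · have hqc := q.2.1.continuous
    obtain ⟨k1, k2, -⟩ := muF_rep ν hl0 hν hqc.measurable hM0 hqM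
    let φ : BddSub d := ⟨fun y => q.1 y / rhoF d y, M, div_rho_bound hM0 hqM⟩
    have hφ0 : ∀ y, 0 ≤ φ.1 y := fun y => div_nonneg (hq0 y) (rhoF_nonneg y)
    have hφM : ∀ y, φ.1 y ≤ M := fun y => (le_abs_self _).trans (div_rho_bound hM0 hqM y)
    let c : ℕ → Euc d → ℝ := fun n y => min 1 (n * ‖y‖)
    have hc0 : ∀ n y, 0 ≤ c n y := fun n y => le_min zero_le_one (by positivity)
    have hc1 : ∀ n y, c n y ≤ 1 := fun n y => min_le_left _ _
    have hcc : ∀ n, Continuous (c n) := fun n => by fun_prop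
    have hb : ∀ n y, |c n y * φ.1 y| ≤ M := fun n y => by
      rw [abs_of_nonneg (mul_nonneg (hc0 n y) (hφ0 y))]
      calc _ ≤ 1 * M := mul_le_mul (hc1 n y) (hφM y) (hφ0 y) zero_le_one
        _ = M := one_mul M
    let φn : ℕ → BddSub d := fun n => ⟨fun y => c n y * φ.1 y, M, hb n⟩
    have hcont : ∀ n, Continuous (φn n).1 := by
      intro n
      rw [continuous_iff_continuousAt]
      intro y
      by_cases hy : y = 0
      · subst hy
        have e0 : (φn n).1 0 = 0 := by simp [φn, c]
        rw [ContinuousAt, e0]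
        refine squeeze_zero (fun z => mul_nonneg (hc0 n z) (hφ0 z)) (g := fun z => c n z * M)
          (fun z => mul_le_mul_of_nonneg_left (hφM z) (hc0 n z)) ?_
        have : Tendsto (fun z => c n z * M) (nhds 0) (nhds (c n 0 * M)) :=
          ((hcc n).mul (continuous_const (y := M))).tendsto (0 : Euc d)
        simpa [c] using this
      · exact (hcc n).continuousAt.mul
          ((hqc.continuousAt).div rhoF_cont.continuousAt (rhoF_pos hy).ne')
    have hle : ∀ n, ∫ y, (φn n).1 y ∂ν ≤ l q := by
      intro n
      rw [← hrep _ (hcont n), ← hTl φ q (mul_div_rho hqM)]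
      exact BddSub_mono hT fun y => by
        change c n y * φ.1 y ≤ φ.1 y
        nlinarith [hc1 n y, hφ0 y]
    have hlim : Tendsto (fun n => ∫ y, (φn n).1 y ∂ν) atTop (nhds (∫ y, φ.1 y ∂ν)) := by
      refine tendsto_integral_of_dominated_convergence (fun _ => M)
        (fun n => (hcont n).aestronglyMeasurable) (integrable_const _)
        (fun n => Eventually.of_forall (hb n)) (Eventually.of_forall fun y => ?_)
      by_cases hy : y = 0
      · subst hy
        have e0 : φ.1 0 = 0 := by simp [φ, rhoF_zero]
        have e1 : ∀ n, (φn n).1 0 = 0 := fun n => by simp [φn, c]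
        simp only [e0, e1]
        exact tendsto_const_nhds
      · refine tendsto_const_nhds.congr' ?_
        have hy' := norm_pos_iff.2 hy
        obtain ⟨N, hN⟩ := exists_nat_ge (1 / ‖y‖)
        filter_upwards [eventually_ge_atTop N] with n hn
        have : (N:ℝ) ≤ n := by exact_mod_cast hn
        have h3 : 1 ≤ n * ‖y‖ := by
          rw [← div_le_iff₀ hy']; linarith
        change _ = min 1 (n * ‖y‖) * φ.1 y
        rw [min_eq_left h3, one_mul]
    rw [k2]
    exact le_of_tendsto' hlim hle

/-- the constant -/
def LamF (d : ℕ) (K : ℝ) : ℝ :=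
  1 + (K * C2Norm (fun _ : Euc d => (1:ℝ)) + (1 + 2 * d) * (K * C2Norm (rhoF d))
    + ∑ i : Fin d, K * C2Norm (linF i) + ∑ i : Fin d, ∑ j : Fin d, K * C2Norm (quadF i j))

lemma norm_le_sum_coord (B : Euc d) : ‖B‖ ≤ ∑ i, |B i| := by
  rw [EuclideanSpace.norm_eq]
  refine Real.sqrt_le_iff.2 ⟨Finset.sum_nonneg fun _ _ => abs_nonneg _, ?_⟩
  exact Finset.sum_sq_le_sq_sum_of_nonneg (fun i _ => abs_nonneg (B i))

lemma courrege {K : ℝ} (hK : 0 ≤ K) (l : C2bSub d →ₗ[ℝ] ℝ)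
    (hlK : ∀ h : C2bSub d, |l h| ≤ K * C2Norm h.1)
    (hl : ∀ h : C2bSub d, (∀ y, 0 ≤ h.1 y) → h.1 0 = 0 → 0 ≤ l h)
    (ht : ∀ ε > 0, ∃ R : ℝ, ∀ h : C2bSub d, (∀ y, 0 ≤ h.1 y) → (∀ y, h.1 y ≤ 1) →
      (∀ y, ‖y‖ < R → h.1 y = 0) → l h ≤ ε) :
    ∃ L : LevyData d, L.base = 0 ∧ LevyBounds (LamF d K) L ∧ ∀ h : C2bSub d, l h = L.apply h.1 := by
  obtain ⟨ν, hν, hR, hq⟩ := levy_core l hl ht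
  set k := K * C2Norm (rhoF d) with hk
  have hk0 : 0 ≤ k := mul_nonneg hK (C2Norm_nonneg _)
  replace hν : ν univ ≤ ENNReal.ofReal k := hν.trans
    (ENNReal.ofReal_le_ofReal ((le_abs_self _).trans (hlK _)))
  let one : C2bSub d := ⟨fun _ => 1, isC2b_const 1⟩
  let lin : Fin d → C2bSub d := fun i => ⟨linF i, linF_C2b i⟩
  let quad : Fin d → Fin d → C2bSub d := fun i j => ⟨quadF i j, quadF_C2b i j⟩
  have hquad := fun i j => muF_rep ν hk0 hν (quadF_C2b i j).1.continuous.measurable zero_le_one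
    (fun y => by rw [one_mul]; exact quadF_le i j y)
  have hcorr := fun i : Fin d => muF_rep ν hk0 hν (corrF_meas i) zero_le_two (corrF_le i)
  let A : Matrix (Fin d) (Fin d) ℝ := fun i j => (1/2) * (l (quad i j) - ∫ y, quadF i j y ∂(muF ν))
  let B : Euc d := WithLp.toLp 2 fun i => l (lin i) + ∫ y, corrF i y ∂(muF ν)
  have hn1 : 0 ≤ K * C2Norm (fun _ : Euc d => (1:ℝ)) := mul_nonneg hK (C2Norm_nonneg _)
  have hn2 : 0 ≤ ∑ i : Fin d, K * C2Norm (linF i) :=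
    Finset.sum_nonneg fun i _ => mul_nonneg hK (C2Norm_nonneg _)
  have hn3 : 0 ≤ ∑ i : Fin d, ∑ j : Fin d, K * C2Norm (quadF i j) :=
    Finset.sum_nonneg fun i _ => Finset.sum_nonneg fun j _ => mul_nonneg hK (C2Norm_nonneg _)
  have hn4 : 0 ≤ 2 * d * k := by positivity
  have hsymm : A.IsSymm := by
    ext i j
    have : quad j i = quad i j := by
      apply Subtype.ext; ext y; simp only [quad, quadF]; ring
    have h2 : quadF j i = quadF (d := d) i j := by ext y; simp only [quadF]; ring
    change (1/2) * (l (quad j i) - ∫ y, quadF j i y ∂(muF ν)) = (1/2) * (l (quad i j) - ∫ y, quadF i j y ∂(muF ν))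
    rw [this, h2]
  refine ⟨⟨0, A, B, l one, muF ν⟩, rfl, ⟨hsymm, ?_, ?_, ?_, ?_, muF_zero ν, ?_⟩, ?_⟩
  · refine Matrix.PosSemidef.of_dotProduct_mulVec_nonneg ?_ fun ξ => ?_
    · rw [Matrix.IsHermitian, Matrix.conjTranspose_eq_transpose_of_trivial]; exact hsymm
    · let q : C2bSub d := ∑ i, ∑ j, (ξ i * ξ j) • quad i j
      have hqv : ∀ y, q.1 y = ∑ i, ∑ j, ξ i * ξ j * quadF i j y := by
        intro y
        simp [q, quad]
      have hqs : ∀ y, q.1 y = (∑ i, ξ i * y i) ^ 2 * bumpN d 0 y := by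
        intro y
        rw [hqv, pow_two, Finset.sum_mul_sum, Finset.sum_mul]
        refine Finset.sum_congr rfl fun i _ => ?_
        rw [Finset.sum_mul]
        refine Finset.sum_congr rfl fun j _ => ?_
        simp only [quadF]; ring
      have h1 := hq q (∑ i, ∑ j, |ξ i * ξ j|)
        (Finset.sum_nonneg fun i _ => Finset.sum_nonneg fun j _ => abs_nonneg _)
        (fun y => by rw [hqs]; exact mul_nonneg (sq_nonneg _) (eta_nonneg y))
        (fun y => by
          rw [hqv, Finset.sum_mul]
          refine (Finset.abs_sum_le_sum_abs _ _).trans (Finset.sum_le_sum fun i _ => ?_)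
          rw [Finset.sum_mul]
          refine (Finset.abs_sum_le_sum_abs _ _).trans (Finset.sum_le_sum fun j _ => ?_)
          rw [abs_mul]
          exact mul_le_mul_of_nonneg_left (quadF_le i j y) (abs_nonneg _))
      have h2 : ∫ y, q.1 y ∂(muF ν) = ∑ i, ∑ j, ξ i * ξ j * ∫ y, quadF i j y ∂(muF ν) := by
        simp_rw [hqv]
        rw [integral_finsetSum _ fun i _ => integrable_finsetSum _ fun j _ => (hquad i j).1.const_mul _]
        refine Finset.sum_congr rfl fun i _ => ?_
        rw [integral_finsetSum _ fun j _ => (hquad i j).1.const_mul _]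
        refine Finset.sum_congr rfl fun j _ => ?_
        rw [integral_const_mul]
      have h3 : l q = ∑ i, ∑ j, ξ i * ξ j * l (quad i j) := by simp [q]
      have h4 : star ξ ⬝ᵥ (A.mulVec ξ) = (1/2) * (l q - ∫ y, q.1 y ∂(muF ν)) := by
        rw [h2, h3, ← Finset.sum_sub_distrib, Finset.mul_sum]
        simp only [dotProduct, Matrix.mulVec, star_trivial]
        refine Finset.sum_congr rfl fun i _ => ?_
        rw [← Finset.sum_sub_distrib, Finset.mul_sum, Finset.mul_sum]
        refine Finset.sum_congr rfl fun j _ => ?_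
        simp only [A]; ring
      rw [h4]; linarith
  · intro i j
    have h1 := hlK (quad i j)
    have h2 := (hquad i j).2.2
    have h3 : K * C2Norm (quadF i j) ≤ ∑ i : Fin d, ∑ j : Fin d, K * C2Norm (quadF i j) := by
      refine le_trans ?_ (Finset.single_le_sum (f := fun i => ∑ j : Fin d, K * C2Norm (quadF i j))
        (fun i _ => Finset.sum_nonneg fun j _ => mul_nonneg hK (C2Norm_nonneg _)) (Finset.mem_univ i))
      exact Finset.single_le_sum (f := fun j => K * C2Norm (quadF i j))
        (fun j _ => mul_nonneg hK (C2Norm_nonneg _)) (Finset.mem_univ j)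
    change |(1/2) * (l (quad i j) - ∫ y, quadF i j y ∂(muF ν))| ≤ _
    change |l (quad i j)| ≤ K * C2Norm (quadF i j) at h1
    rw [LamF, ← hk]
    rw [abs_le] at h1 h2 ⊢
    constructor <;> linarith [h1.1, h1.2, h2.1, h2.2]
  · refine (norm_le_sum_coord B).trans ?_
    have : ∑ i, |B i| ≤ ∑ i : Fin d, (K * C2Norm (linF i) + 2 * k) := by
      refine Finset.sum_le_sum fun i _ => ?_
      exact (abs_add_le _ _).trans (add_le_add (hlK (lin i)) (hcorr i).2.2)
    rw [Finset.sum_add_distrib, Finset.sum_const, Finset.card_univ, Fintype.card_fin,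
      nsmul_eq_mul] at this
    rw [LamF, ← hk]
    linarith
  · refine (hlK one).trans ?_
    change K * C2Norm (fun _ : Euc d => (1:ℝ)) ≤ _
    rw [LamF, ← hk]
    linarith
  · have hm := muF_rep ν hk0 hν (f := fun y => min 1 (‖y‖ ^ 2)) (by fun_prop) zero_le_one
      (fun y => by
        rw [one_mul, abs_of_nonneg (le_min zero_le_one (by positivity))]; exact min_le_rhoF y)
    simp only [sub_zero]
    rw [← ofReal_integral_eq_lintegral_ofReal hm.1
      (Eventually.of_forall fun y => le_min zero_le_one (by positivity))]
    refine ENNReal.ofReal_le_ofReal ((le_abs_self _).trans (hm.2.2.trans ?_))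
    rw [LamF, ← hk]
    linarith
  · intro h
    let e : Fin d → Euc d := fun i => EuclideanSpace.single i (1:ℝ)
    let g : Fin d → ℝ := fun i => fderiv ℝ h.1 0 (e i)
    let H : Fin d → Fin d → ℝ := fun i j => fderiv ℝ (fderiv ℝ h.1) 0 (e i) (e j)
    have hexp : ∀ y : Euc d, y = ∑ i, y i • e i := by
      intro y
      ext k
      simp [e, Finset.sum_apply, Pi.single_apply]
    have hg : ∀ y, fderiv ℝ h.1 0 y = ∑ i, g i * y i := by
      intro y
      conv_lhs => rw [hexp y]
      simp [g, mul_comm]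
    have hH : ∀ y, fderiv ℝ (fderiv ℝ h.1) 0 y y = ∑ i, ∑ j, H i j * (y i * y j) := by
      intro y
      conv_lhs => rw [hexp y]
      simp only [map_sum, map_smul, sum_apply, smul_apply,
        smul_eq_mul, Finset.mul_sum]
      rw [Finset.sum_comm]
      refine Finset.sum_congr rfl fun i _ => Finset.sum_congr rfl fun j _ => ?_
      simp only [H]; ring
    let R : C2bSub d := h - h.1 0 • one - ∑ i, g i • lin i - ∑ i, ∑ j, ((1/2) * H i j) • quad i j
    have hRv : ∀ y, R.1 y = h.1 y - h.1 0 - ∑ i, g i * linF i y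
        - ∑ i, ∑ j, (1/2) * H i j * quadF i j y := by
      intro y
      simp [R, one, lin, quad]
    obtain ⟨r1, r2⟩ := hR R (by
      intro ε hε
      obtain ⟨δ, hδ, hδ'⟩ := taylor_two h.2.1 hε
      refine ⟨min δ 1, by positivity, fun z hz => ?_⟩
      refine le_trans (le_of_eq ?_) (hδ' z (hz.trans_le (min_le_left _ _)))
      rw [hRv, hg, hH]
      simp only [linF, quadF, eta_one (hz.trans_le (min_le_right _ _)).le, mul_one, Finset.mul_sum,
        mul_assoc])
    have hlh : l h = h.1 0 * l one + ∑ i, g i * l (lin i)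
        + ∑ i, ∑ j, (1/2) * H i j * l (quad i j) + l R := by
      simp [R]
    have hint : ∫ y, (h.1 y - h.1 0 -
        Set.indicator (ball (0 : Euc d) 1) (fun z => fderiv ℝ h.1 0 (z - 0)) y) ∂(muF ν)
        = ∫ y, R.1 y ∂(muF ν) - ∑ i, g i * ∫ y, corrF i y ∂(muF ν)
          + ∑ i, ∑ j, (1/2) * H i j * ∫ y, quadF i j y ∂(muF ν) := by
      have e1 : ∀ y, h.1 y - h.1 0 -
        Set.indicator (ball (0 : Euc d) 1) (fun z => fderiv ℝ h.1 0 (z - 0)) y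
        = R.1 y - (∑ i, g i * corrF i y) + ∑ i, ∑ j, (1/2) * H i j * quadF i j y := by
        intro y
        have e2 : Set.indicator (ball (0 : Euc d) 1) (fun z => fderiv ℝ h.1 0 (z - 0)) y
          = ∑ i, g i * linF i y + ∑ i, g i * corrF i y := by
          rw [← Finset.sum_add_distrib]
          simp only [linF, corrF]
          by_cases hy : y ∈ ball (0 : Euc d) 1
          · rw [Set.indicator_of_mem hy, Set.indicator_of_mem hy, sub_zero, hg]
            refine Finset.sum_congr rfl fun i _ => ?_
            ring
          · rw [Set.indicator_of_notMem hy, Set.indicator_of_notMem hy]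
            symm
            refine Finset.sum_eq_zero fun i _ => ?_
            ring
        rw [e2, hRv]; ring
      simp_rw [e1]
      have i1 : Integrable (fun y => ∑ i, g i * corrF i y) (muF ν) :=
        integrable_finsetSum _ fun i _ => (hcorr i).1.const_mul _
      have i2 : Integrable (fun y => ∑ i, ∑ j, (1/2) * H i j * quadF i j y) (muF ν) :=
        integrable_finsetSum _ fun i _ => integrable_finsetSum _ fun j _ => (hquad i j).1.const_mul _
      have i3 : Integrable (fun y => R.1 y - ∑ i, g i * corrF i y) (muF ν) := r1.sub i1
      rw [integral_add i3 i2, integral_sub r1 i1]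
      congr 1
      · congr 1
        rw [integral_finsetSum _ fun i _ => (hcorr i).1.const_mul _]
        simp_rw [integral_const_mul]
      · rw [integral_finsetSum _ fun i _ => integrable_finsetSum _ fun j _ => (hquad i j).1.const_mul _]
        refine Finset.sum_congr rfl fun i _ => ?_
        rw [integral_finsetSum _ fun j _ => (hquad i j).1.const_mul _]
        simp_rw [integral_const_mul]
    rw [hlh, r2]
    simp only [LevyData.apply]
    rw [hint]
    have eB : fderiv ℝ h.1 0 B = ∑ i, g i * l (lin i) + ∑ i, g i * ∫ y, corrF i y ∂(muF ν) := by
      rw [hg, ← Finset.sum_add_distrib]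
      refine Finset.sum_congr rfl fun i _ => ?_
      change g i * (l (lin i) + ∫ y, corrF i y ∂(muF ν)) = _
      ring
    have eA : (∑ i, ∑ j, A i j * iteratedFDeriv ℝ 2 h.1 0
        ![EuclideanSpace.single i (1:ℝ), EuclideanSpace.single j (1:ℝ)])
        = ∑ i, ∑ j, (1/2) * H i j * l (quad i j)
          - ∑ i, ∑ j, (1/2) * H i j * ∫ y, quadF i j y ∂(muF ν) := by
      rw [← Finset.sum_sub_distrib]
      refine Finset.sum_congr rfl fun i _ => ?_
      rw [← Finset.sum_sub_distrib]
      refine Finset.sum_congr rfl fun j _ => ?_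
      rw [iteratedFDeriv_two_apply]
      simp only [A, H, e, Matrix.cons_val_zero, Matrix.cons_val_one]
      ring
    rw [eA, eB]
    ring

/-- translation of a Levy functional based at the origin -/
def shiftL (L : LevyData d) (x : Euc d) : LevyData d :=
  ⟨x, L.A, L.B, L.C, L.μ.map (fun y => y + x)⟩

lemma shiftL_apply (L : LevyData d) (hL : L.base = 0) (x : Euc d) (w : Euc d → ℝ) :
    (shiftL L x).apply w = L.apply (fun y => w (y + x)) := by
  simp only [LevyData.apply, shiftL, hL]
  rw [(measurableEmbedding_addRight x).integral_map, fderiv_comp_add_right]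
  simp only [iteratedFDeriv_comp_add_right, zero_add, add_sub_cancel_right, sub_zero]
  congr 1
  refine integral_congr_ae (Eventually.of_forall fun y => ?_)
  simp only [Set.indicator, mem_ball, dist_zero_right, dist_eq_norm, add_sub_cancel_right, sub_zero]

lemma shiftL_bounds {L : LevyData d} (hL : L.base = 0) {Λ : ℝ} (h : LevyBounds Λ L) (x : Euc d) :
    LevyBounds Λ (shiftL L x) := by
  obtain ⟨h1, h2, h3, h4, h5, h6, h7⟩ := h
  refine ⟨h1, h2, h3, h4, h5, ?_, ?_⟩
  · simp only [shiftL]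
    rw [(measurableEmbedding_addRight x).map_apply]
    have : (fun y => y + x) ⁻¹' {x} = {L.base} := by ext y; simp [hL]
    rw [this, h6]
  · simp only [shiftL]
    rw [(measurableEmbedding_addRight x).lintegral_map]
    simpa [hL] using h7

lemma local_zero {r : ℝ} {f : Euc d → ℝ} (hf : ∀ y, ‖y‖ < r + 1 → f y = 0) : localC2Norm r f = 0 := by
  have hev : ∀ y ∈ closedBall (0 : Euc d) r, f =ᶠ[nhds y] fun _ => 0 := by
    intro y hy
    have : ball (0 : Euc d) (r + 1) ∈ nhds y := isOpen_ball.mem_nhds (by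
      simp at hy ⊢; linarith)
    filter_upwards [this] with z hz
    exact hf z (by simpa using hz)
  have h1 : localSup r f = 0 := by
    unfold localSup
    have : ∀ y, (⨆ (_ : y ∈ closedBall (0 : Euc d) r), |f y|) = 0 := fun y => by
      by_cases hy : y ∈ closedBall (0 : Euc d) r
      · have := (hev y hy).eq_of_nhds
        simp [this]
      · simp [hy]
    simp only [this, ciSup_const]
  have h2 : localGradSup r f = 0 := by
    unfold localGradSup
    have : ∀ y, (⨆ (_ : y ∈ closedBall (0 : Euc d) r), ‖fderiv ℝ f y‖) = 0 := fun y => by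
      by_cases hy : y ∈ closedBall (0 : Euc d) r
      · have := (hev y hy).fderiv_eq (𝕜 := ℝ)
        simp [this]
      · simp [hy]
    simp only [this, ciSup_const]
  have h3 : localHessSup r f = 0 := by
    unfold localHessSup
    have : ∀ y, (⨆ (_ : y ∈ closedBall (0 : Euc d) r), ‖iteratedFDeriv ℝ 2 f y‖) = 0 := fun y => by
      by_cases hy : y ∈ closedBall (0 : Euc d) r
      · have := ((hev y hy).iteratedFDeriv ℝ 2).eq_of_nhds
        rw [iteratedFDeriv_const_of_ne (by norm_num)] at this
        simp [this]
      · simp [hy]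
    simp only [this, ciSup_const]
  rw [localC2Norm, h1, h2, h3]; ring

lemma exists_levy {K : ℝ} (hK : 0 ≤ K) (I : (Euc d → ℝ) → Euc d → ℝ)
    (hLip : LipWith K IsC2b C2Norm I) (hG : GCP IsC2b I) (hLoc : Locality IsC2b localC2Norm I)
    (hC : ConvexOp IsC2b I) (v : Euc d → ℝ) (hv : IsC2b v) (x : Euc d) :
    ∃ L : LevyData d, L.base = x ∧ LevyBounds (LamF d K) L ∧
      ∀ u, IsC2b u → I v x + L.apply (fun y => u y - v y) ≤ I u x := by
  have hmem : ∀ h : C2bSub d, IsC2b (fun y => v y + h.1 (y - x)) := fun h =>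
    (C2bSub d).add_mem hv (h.2.comp_sub x)
  obtain ⟨l, hl⟩ := exists_subgradient (fun h : C2bSub d => I (fun y => v y + h.1 (y - x)) x) (by
    intro a b t ht
    refine le_trans (le_of_eq ?_) (hC _ _ (hmem a) (hmem b) t ht x)
    congr 1
    ext y
    simp only [Submodule.coe_add, Submodule.coe_smul, Pi.add_apply, Pi.smul_apply, smul_eq_mul]
    ring)
  have h0 : (fun y => v y + (0 : C2bSub d).1 (y - x)) = v := by ext y; simp
  simp only [h0] at hl
  have hsub : ∀ h : C2bSub d, (fun y => (v y + h.1 (y - x)) - v y) = fun y => h.1 (y - x) := by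
    intro h; ext y; ring
  have hle : ∀ h : C2bSub d, l h ≤ K * C2Norm h.1 := by
    intro h
    have h1 := hLip _ _ (hmem h) hv x
    rw [hsub, C2Norm_comp_sub] at h1
    have h2 := hl h
    linarith [le_abs_self (I (fun y => v y + h.1 (y - x)) x - I v x)]
  obtain ⟨L, hL0, hLb, hLa⟩ := courrege hK l (by
    intro h
    have h1 := hle h
    have h2 := hle (-h)
    rw [map_neg, Submodule.coe_neg, C2Norm_neg] at h2
    exact abs_le.2 ⟨by linarith, h1⟩) (by
    intro h hp hz
    have h1 := hl (-h)
    have h2 := hG _ _ (hmem (-h)) hv (fun y => by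
      have := hp (y - x)
      simp only [Submodule.coe_neg, Pi.neg_apply]; linarith) x (by simp [hz])
    rw [map_neg] at h1
    linarith) (by
    intro ε hε
    obtain ⟨C₀, ω, hω, hωt, r₀, hr⟩ := hLoc
    have ht : Tendsto (fun r => C₀ * ω r) atTop (nhds 0) := by simpa using hωt.const_mul C₀
    have hev := (ht.eventually (gt_mem_nhds hε)).and
      ((eventually_ge_atTop r₀).and (eventually_ge_atTop ‖x‖))
    obtain ⟨r, hr1, hr2, hr3⟩ := hev.exists
    refine ⟨2 * r + 1 + ‖x‖, fun h hp h1 hz => ?_⟩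
    have k1 := hr r hr2 _ _ (hmem h) hv x hr3
    rw [hsub, local_zero (r := 2 * r) (fun y hy => hz _ (by
      linarith [norm_sub_le y x])), mul_zero, zero_add] at k1
    have k2 := hl h
    have k3 : supNorm (fun y => h.1 (y - x)) ≤ 1 :=
      Real.iSup_le (fun y => by rw [abs_of_nonneg (hp _)]; exact h1 _) zero_le_one
    have k4 : 0 ≤ supNorm (fun y => h.1 (y - x)) := Real.iSup_nonneg fun _ => abs_nonneg _
    have k5 : C₀ * ω r * supNorm (fun y => h.1 (y - x)) ≤ ε := by
      calc _ ≤ ε * supNorm (fun y => h.1 (y - x)) := mul_le_mul_of_nonneg_right hr1.le k4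
        _ ≤ ε * 1 := mul_le_mul_of_nonneg_left k3 hε.le
        _ = ε := mul_one ε
    linarith [le_abs_self (I (fun y => v y + h.1 (y - x)) x - I v x)])
  refine ⟨shiftL L x, rfl, shiftL_bounds hL0 hLb x, fun u hu => ?_⟩
  have huv : IsC2b (fun y => u y - v y) := (C2bSub d).sub_mem hu hv
  have hw : IsC2b (fun y => u (y + x) - v (y + x)) := by
    have := huv.comp_sub (-x)
    simpa using this
  have h1 := hl ⟨_, hw⟩
  rw [hLa] at h1
  rw [shiftL_apply L hL0]
  simpa using h1

lemma apply_zero' (L : LevyData d) (u : Euc d → ℝ) : L.apply (fun y => u y - u y) = 0 := by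
  have h2 : iteratedFDeriv ℝ 2 (fun _ : Euc d => (0:ℝ)) L.base = 0 := by
    rw [iteratedFDeriv_const_of_ne (by norm_num)]; rfl
  simp [LevyData.apply, h2]

/-- for a *convex* Lipschitz operator `I : C²_b(ℝ^d) → C_b(ℝ^d)` with the
GCP and the locality assumption, the min-max representation reduces to a max formula:
there is a selection `(v, x) ↦ L_{v,x}` of uniformly bounded Lévy-type functionals based
at `x` supporting `I` from below at `v`, and `I(u)(x)` is the supremum over `v` of
`I(v)(x) + L_{v,x}(u - v)`, attained at `v = u`. -/
theorem max_formula_convex (d : ℕ) (hd : 1 ≤ d) (K₀ : ℝ) (hK₀ : 0 ≤ K₀) :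
    ∃ Λ : ℝ, 0 < Λ ∧
      ∀ I : (Euc d → ℝ) → Euc d → ℝ,
        (∀ u, IsC2b u → IsCb (I u)) →
        LipWith K₀ IsC2b C2Norm I →
        GCP IsC2b I →
        Locality IsC2b localC2Norm I →
        ConvexOp IsC2b I →
        ∃ Lsel : (Euc d → ℝ) → Euc d → LevyData d,
          (∀ v, IsC2b v → ∀ x : Euc d,
            (Lsel v x).base = x ∧ LevyBounds Λ (Lsel v x) ∧
            ∀ u, IsC2b u → I v x + (Lsel v x).apply (fun y => u y - v y) ≤ I u x) ∧
          (∀ u, IsC2b u → ∀ x : Euc d,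
            I u x = sSup {r : ℝ | ∃ v, IsC2b v ∧
                r = I v x + (Lsel v x).apply (fun y => u y - v y)} ∧
            I u x + (Lsel u x).apply (fun y => u y - u y) = I u x) := by
  have hpos : 0 ≤ LamF d K₀ - 1 := by
    have h0 : ∀ f : Euc d → ℝ, 0 ≤ K₀ * C2Norm f := fun f => mul_nonneg hK₀ (C2Norm_nonneg f)
    have h1 := h0 (fun _ => 1)
    have h2 : 0 ≤ (1 + 2 * (d:ℝ)) * (K₀ * C2Norm (rhoF d)) := mul_nonneg (by positivity) (h0 _)
    have h3 : 0 ≤ ∑ i : Fin d, K₀ * C2Norm (linF i) := Finset.sum_nonneg fun i _ => h0 _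
    have h4 : 0 ≤ ∑ i : Fin d, ∑ j : Fin d, K₀ * C2Norm (quadF i j) :=
      Finset.sum_nonneg fun i _ => Finset.sum_nonneg fun j _ => h0 _
    rw [LamF]; linarith
  refine ⟨LamF d K₀, by linarith, fun I _ hLip hG hLoc hC => ?_⟩
  have key : ∀ (v : Euc d → ℝ) (x : Euc d), ∃ L : LevyData d, IsC2b v →
      (L.base = x ∧ LevyBounds (LamF d K₀) L ∧
        ∀ u, IsC2b u → I v x + L.apply (fun y => u y - v y) ≤ I u x) := by
    intro v x
    by_cases hv : IsC2b v
    · obtain ⟨L, hL⟩ := exists_levy hK₀ I hLip hG hLoc hC v hv x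
      exact ⟨L, fun _ => hL⟩
    · exact ⟨⟨0, 0, 0, 0, 0⟩, fun h => absurd h hv⟩
  choose Lsel hsel using key
  refine ⟨Lsel, fun v hv x => hsel v x hv, fun u hu x => ⟨?_, ?_⟩⟩
  · symm
    refine IsGreatest.csSup_eq ⟨⟨u, hu, ?_⟩, ?_⟩
    · rw [apply_zero', add_zero]
    · rintro r ⟨v, hv, rfl⟩
      exact (hsel v x hv).2.2 u hu
  · rw [apply_zero', add_zero]

end
end

section
/- Let d ≥ 1, γ ∈ (0,1) and λ ∈ (0,1]. There exist constants h₀ = h₀(d) > 0 and C = C(d,γ,λ) with the following property: for every h ∈ (0,h₀] and every (h,λ)-net G ⊆ ℝ^d there exists a linear map E from bounded real-valued functions on G to functions on ℝ^d such that: (i) E(g)(x) = g(x) for every x ∈ G; (ii) for every u ∈ C^{1,γ}_b(ℝ^d), E(u|_G) ∈ C^{1,γ}_b(ℝ^d) and ‖E(u|_G)‖_{C^{1,γ}} ≤ C·‖u‖_{C^{1,γ}}; (iii) for every u ∈ C²_b(ℝ^d), ‖E(u|_G) − u‖_{C^{1,γ}} ≤ C · h^{1−γ} · ‖u‖_{C²};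 and (iv) E is almost order preserving: for every u ∈ C³_b(ℝ^d) with u ≥ 0 on G and u(x₀) = 0 at some x₀ ∈ G, there exists a function R ∈ C^{1,γ}_b(ℝ^d) with R(x₀) = 0, E(u|_G) + R ≥ 0 on all of ℝ^d, and ‖R‖_{C^{1,γ}} ≤ C · h^{1−γ} · ‖u‖_{C³}. -/
open Metric Set

noncomputable section

variable {d : ℕ}

/-- `γ`-Hölder seminorm of the gradient -/
def gradHolderSemi (γ : ℝ) (u : Euc d → ℝ) : ℝ :=
  sInf {M : ℝ | 0 ≤ M ∧ ∀ x y, ‖fderiv ℝ u x - fderiv ℝ u y‖ ≤ M * ‖x - y‖ ^ γ}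

/-- the `C^{1,γ}` norm : `sup|u| + sup|∇u| + [∇u]_γ` -/
def C1HolderNorm (γ : ℝ) (u : Euc d → ℝ) : ℝ := supNorm u + gradSup u + gradHolderSemi γ u

/-- membership in `C^{1,γ}_b(ℝ^d)` -/
def IsC1Holder (γ : ℝ) (u : Euc d → ℝ) : Prop :=
  ContDiff ℝ 1 u ∧ (∃ M : ℝ, ∀ x, |u x| ≤ M ∧ ‖fderiv ℝ u x‖ ≤ M) ∧
    ∃ M : ℝ, ∀ x y, ‖fderiv ℝ u x - fderiv ℝ u y‖ ≤ M * ‖x - y‖ ^ γ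

/-- the `C³` norm : sum of sup norms of `u` and its first three derivatives -/
def C3Norm (u : Euc d → ℝ) : ℝ := ∑ i ∈ Finset.range 4, ⨆ x, ‖iteratedFDeriv ℝ i u x‖

def IsC3b (u : Euc d → ℝ) : Prop :=
  ContDiff ℝ 3 u ∧ ∀ i ≤ 3, ∃ M : ℝ, ∀ x, ‖iteratedFDeriv ℝ i u x‖ ≤ M

def IsNet (h lam : ℝ) (G : Set (Euc d)) : Prop :=
  G.Nonempty ∧ (∀ x : Euc d, Metric.infDist x G ≤ h) ∧
    ∀ x ∈ G, ∀ y ∈ G, x ≠ y → lam * h ≤ dist x y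

def BddFun {G : Set (Euc d)} (g : G → ℝ) : Prop := ∃ M : ℝ, ∀ p, |g p| ≤ M

lemma packing (d : ℕ) (μ ρ : ℝ) (hμ : 0 < μ) : ∃ N : ℕ, ∀ (I : Type) (z : I → Euc d),
    (∀ i j, i ≠ j → μ ≤ dist (z i) (z j)) → ∀ x,
      {i | dist (z i) x ≤ ρ}.Finite ∧ {i | dist (z i) x ≤ ρ}.ncard ≤ N := by
  obtain ⟨t, -, htf, ht⟩ := (isCompact_closedBall (0 : Euc d) ρ).finite_cover_balls
    (half_pos hμ)
  refine ⟨t.ncard, fun I z hz x => ?_⟩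
  have h1 : ∀ i, ∃ y, dist (z i) x ≤ ρ → y ∈ t ∧ dist (z i - x) y < μ / 2 := by
    intro i
    by_cases hi : dist (z i) x ≤ ρ
    · have : z i - x ∈ closedBall (0 : Euc d) ρ := by
        simpa [dist_eq_norm] using hi
      have := ht this
      simp only [mem_iUnion, mem_ball, exists_prop] at this
      obtain ⟨y, hy, hy2⟩ := this
      exact ⟨y, fun _ => ⟨hy, hy2⟩⟩
    · exact ⟨0, fun h => absurd h hi⟩
  choose y hy using h1
  have hinj : Set.InjOn y {i | dist (z i) x ≤ ρ} := by
    intro i hi j hj hij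
    by_contra hne
    have h1 := (hy i hi).2
    have h2 := (hy j hj).2
    rw [← hij] at h2
    have h3 := dist_triangle_right (z i - x) (z j - x) (y i)
    rw [dist_sub_right] at h3
    have := hz i j hne
    linarith
  have hmaps : Set.MapsTo y {i | dist (z i) x ≤ ρ} t := fun i hi => (hy i hi).1
  exact ⟨Set.Finite.of_injOn hmaps hinj htf, Set.ncard_le_ncard_of_injOn y hmaps hinj htf⟩

/-- sums of translated bumps -/
def bsum {d : ℕ} {I : Type} (Φ : Euc d → ℝ) (z : I → Euc d) (c : I → ℝ) (x : Euc d) : ℝ :=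
  ∑ᶠ i, c i * Φ (x - z i)

lemma bsum_support {d : ℕ} {I : Type} {Φ : Euc d → ℝ} {r : ℝ} (hr : ∀ w, Φ w ≠ 0 → ‖w‖ ≤ r)
    (z : I → Euc d) (c : I → ℝ) (x : Euc d) :
    (Function.support fun i => c i * Φ (x - z i)) ⊆ {i | dist (z i) x ≤ r} := by
  intro i hi
  have := hr _ (right_ne_zero_of_mul hi)
  simpa [dist_eq_norm, norm_sub_rev] using this

lemma bsum_finite {d : ℕ} {I : Type} {Φ : Euc d → ℝ} {r μ : ℝ} (hμ : 0 < μ)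
    (hr : ∀ w, Φ w ≠ 0 → ‖w‖ ≤ r)
    (z : I → Euc d) (hz : ∀ i j, i ≠ j → μ ≤ dist (z i) (z j)) (c : I → ℝ) (x : Euc d) :
    (Function.support fun i => c i * Φ (x - z i)).Finite := by
  obtain ⟨N, hN⟩ := packing d μ r hμ
  exact (hN I z hz x).1.subset (bsum_support hr z c x)

lemma bsum_bounds {d : ℕ} (Φ : Euc d → ℝ) (hΦ : ContDiff ℝ 2 Φ) (r μ : ℝ) (hμ : 0 < μ)
    (hr : ∀ w, Φ w ≠ 0 → ‖w‖ ≤ r) : ∃ K : ℝ, 0 < K ∧ ∀ (I : Type) (z : I → Euc d),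
    (∀ i j, i ≠ j → μ ≤ dist (z i) (z j)) → ∀ c : I → ℝ, ContDiff ℝ 2 (bsum Φ z c) ∧
      ∀ x A, 0 ≤ A → (∀ i, dist (z i) x ≤ r + 2 → |c i| ≤ A) →
        |bsum Φ z c x| ≤ K * A ∧ ‖fderiv ℝ (bsum Φ z c) x‖ ≤ K * A ∧
        ∀ y, ‖y - x‖ ≤ 1 →
          ‖fderiv ℝ (bsum Φ z c) y - fderiv ℝ (bsum Φ z c) x‖ ≤ K * A * ‖y - x‖ := by
  obtain ⟨N, hN⟩ := packing d μ (r + 2) hμ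
  have hcs : HasCompactSupport Φ := by
    refine HasCompactSupport.intro (isCompact_closedBall (0 : Euc d) r) ?_
    intro x hx
    by_contra h
    exact hx (by simpa using hr x h)
  have hD : ContDiff ℝ 1 (fderiv ℝ Φ) := hΦ.fderiv_right (by norm_num)
  obtain ⟨B0, hB0⟩ := hcs.exists_bound_of_continuous hΦ.continuous
  obtain ⟨B1, hB1⟩ := (hcs.fderiv ℝ).exists_bound_of_continuous hD.continuous
  obtain ⟨L, hL⟩ := hD.lipschitzWith_of_hasCompactSupport (hcs.fderiv ℝ) (by norm_num)
  have hdiff : Differentiable ℝ Φ := hΦ.differentiable (by norm_num)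
  set K0 : ℝ := |B0| + |B1| + L + 1 with hK0
  have hL0 : (0 : ℝ) ≤ L := L.2
  have hK0p : 0 < K0 := by positivity
  have hb0 : ∀ x, |Φ x| ≤ K0 := fun x => by
    have := hB0 x
    rw [Real.norm_eq_abs] at this
    linarith [le_abs_self B0, abs_nonneg B1]
  have hb1 : ∀ x, ‖fderiv ℝ Φ x‖ ≤ K0 := fun x => by
    have := hB1 x
    linarith [le_abs_self B1, abs_nonneg B0]
  have hb2 : ∀ x y, ‖fderiv ℝ Φ x - fderiv ℝ Φ y‖ ≤ K0 * ‖x - y‖ := fun x y => by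
    have := hL.dist_le_mul x y
    rw [dist_eq_norm, dist_eq_norm] at this
    refine this.trans ?_
    gcongr
    linarith [abs_nonneg B1, abs_nonneg B0]
  refine ⟨(N + 1) * K0, by positivity, fun I z hz c => ?_⟩
  have key : ∀ x, ∃ S : Finset I, (S.card : ℝ) ≤ N + 1 ∧ (∀ i ∈ S, dist (z i) x ≤ r + 2) ∧
      ∀ y, ‖y - x‖ < 2 → bsum Φ z c =ᶠ[nhds y] fun w => ∑ i ∈ S, c i * Φ (w - z i) := by
    intro x
    obtain ⟨hf, hc⟩ := hN I z hz x
    refine ⟨hf.toFinset, ?_, ?_, ?_⟩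
    · rw [← Set.ncard_eq_toFinset_card _ hf]
      exact_mod_cast hc.trans (Nat.le_succ _)
    · intro i hi
      simpa using hi
    · intro y hy
      have : ball x 2 ∈ nhds y := isOpen_ball.mem_nhds (by simpa [dist_eq_norm] using hy)
      filter_upwards [this] with w hw
      refine finsum_eq_sum_of_support_subset _ ?_
      refine (bsum_support hr z c w).trans ?_
      intro i hi
      simp only [Finite.coe_toFinset, mem_ofPred_eq] at hi ⊢
      have := dist_triangle (z i) w x
      have := mem_ball.1 hw
      linarith
  have hdt : ∀ i, Differentiable ℝ fun w => c i * Φ (w - z i) := fun i => by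
    fun_prop
  have hfd : ∀ i y, fderiv ℝ (fun w => c i * Φ (w - z i)) y = c i • fderiv ℝ Φ (y - z i) := by
    intro i y
    rw [fderiv_const_mul (by fun_prop), fderiv_comp_sub]
  have key2 : ∀ (S : Finset I) y, bsum Φ z c =ᶠ[nhds y] (fun w => ∑ i ∈ S, c i * Φ (w - z i)) →
      fderiv ℝ (bsum Φ z c) y = ∑ i ∈ S, c i • fderiv ℝ Φ (y - z i) := by
    intro S y h
    rw [h.fderiv_eq, fderiv_fun_sum (fun i _ => hdt i y)]
    exact Finset.sum_congr rfl fun i _ => hfd i y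
  constructor
  · rw [contDiff_iff_contDiffAt]
    intro x
    obtain ⟨S, -, -, hS⟩ := key x
    refine ContDiffAt.congr_of_eventuallyEq ?_ (hS x (by simp))
    apply ContDiff.contDiffAt
    fun_prop
  · intro x A hA hcA
    obtain ⟨S, hcard, hSd, hS⟩ := key x
    have hx := hS x (by simp)
    have hsum : ∀ q : ℝ, 0 ≤ q → ∑ i ∈ S, A * (K0 * q) ≤ (N + 1) * K0 * A * q := by
      intro q hq
      rw [Finset.sum_const, nsmul_eq_mul]
      have : 0 ≤ A * (K0 * q) := by positivity
      nlinarith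
    refine ⟨?_, ?_, ?_⟩
    · rw [hx.eq_of_nhds]
      refine (Finset.abs_sum_le_sum_abs _ _).trans ((Finset.sum_le_sum fun i hi => ?_).trans
        ((hsum 1 zero_le_one).trans_eq (mul_one _)))
      rw [abs_mul, mul_one]
      exact mul_le_mul (hcA i (hSd i hi)) (hb0 _) (abs_nonneg _) hA
    · rw [key2 S x hx]
      refine (norm_sum_le _ _).trans ((Finset.sum_le_sum fun i hi => ?_).trans
        ((hsum 1 zero_le_one).trans_eq (mul_one _)))
      rw [norm_smul, mul_one, Real.norm_eq_abs]
      exact mul_le_mul (hcA i (hSd i hi)) (hb1 _) (norm_nonneg _) hA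
    · intro y hy
      rw [key2 S x hx, key2 S y (hS y (by linarith)), ← Finset.sum_sub_distrib]
      refine (norm_sum_le _ _).trans ((Finset.sum_le_sum fun i hi => ?_).trans
        (hsum ‖y - x‖ (norm_nonneg _)))
      rw [← smul_sub, norm_smul, Real.norm_eq_abs]
      refine mul_le_mul (hcA i (hSd i hi)) ?_ (norm_nonneg _) hA
      have := hb2 (y - z i) (x - z i)
      rwa [sub_sub_sub_cancel_right] at this

lemma bsum_scaled {d : ℕ} (Φ : Euc d → ℝ) (hΦ : ContDiff ℝ 2 Φ) (r μ : ℝ) (hμ : 0 < μ)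
    (hr : ∀ w, Φ w ≠ 0 → ‖w‖ ≤ r) : ∃ K : ℝ, 0 < K ∧ ∀ (I : Type) (z : I → Euc d),
    (∀ i j, i ≠ j → μ ≤ dist (z i) (z j)) → ∀ (c : I → ℝ) (h : ℝ), 0 < h →
      ContDiff ℝ 2 (fun x => bsum Φ z c (h⁻¹ • x)) ∧
      ∀ x A, 0 ≤ A → (∀ i, ‖h • z i - x‖ ≤ (r + 2) * h → |c i| ≤ A) →
        |bsum Φ z c (h⁻¹ • x)| ≤ K * A ∧
        ‖fderiv ℝ (fun x => bsum Φ z c (h⁻¹ • x)) x‖ ≤ K * (A / h) ∧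
        ∀ y, ‖y - x‖ ≤ h →
          ‖fderiv ℝ (fun x => bsum Φ z c (h⁻¹ • x)) y
            - fderiv ℝ (fun x => bsum Φ z c (h⁻¹ • x)) x‖ ≤ K * (A / h) * (‖y - x‖ / h) := by
  obtain ⟨K, hK, H⟩ := bsum_bounds Φ hΦ r μ hμ hr
  refine ⟨K, hK, fun I z hz c h hh => ?_⟩
  obtain ⟨H1, H2⟩ := H I z hz c
  refine ⟨H1.comp (contDiff_const_smul _), fun x A hA hc => ?_⟩
  have hn : ∀ v : Euc d, ‖h⁻¹ • v‖ = ‖v‖ / h := fun v => by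
    rw [norm_smul, norm_inv, Real.norm_of_nonneg hh.le]; field_simp
  obtain ⟨h1, h2, h3⟩ := H2 (h⁻¹ • x) A hA (fun i hi => hc i (by
    have : h • z i - x = h • (z i - h⁻¹ • x) := by
      rw [smul_sub, smul_inv_smul₀ hh.ne']
    rw [this, norm_smul, Real.norm_of_nonneg hh.le, mul_comm]
    rw [dist_eq_norm] at hi
    gcongr))
  have hfd : ∀ y, fderiv ℝ (fun x => bsum Φ z c (h⁻¹ • x)) y
      = h⁻¹ • fderiv ℝ (bsum Φ z c) (h⁻¹ • y) := fun y => by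
    have := fderiv_comp_smul (𝕜 := ℝ) (f := bsum Φ z c) (x := y) h⁻¹
    exact this
  refine ⟨h1, ?_, fun y hy => ?_⟩
  · rw [hfd, norm_smul, norm_inv, Real.norm_of_nonneg hh.le]
    calc h⁻¹ * _ ≤ h⁻¹ * (K * A) := by gcongr
      _ = _ := by field_simp
  · rw [hfd, hfd, ← smul_sub, norm_smul, norm_inv, Real.norm_of_nonneg hh.le]
    have h4 := h3 (h⁻¹ • y) (by rw [← smul_sub, hn, div_le_one hh]; exact hy)
    rw [← smul_sub, hn] at h4
    calc h⁻¹ * _ ≤ h⁻¹ * (K * A * (‖y - x‖ / h)) := by gcongr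
      _ = _ := by field_simp

lemma net_hull {d : ℕ} {h lam : ℝ} (hh : 0 < h) (hl : 0 < lam) {G : Set (Euc d)}
    (hG : IsNet h lam G) (y : Euc d) : ∃ (T : Finset G) (w : G → ℝ), (∀ p ∈ T, 0 ≤ w p) ∧
      ∑ p ∈ T, w p = 1 ∧ ∑ p ∈ T, w p • p.1 = y ∧ ∀ p ∈ T, ‖p.1 - y‖ ≤ 3 * h := by
  classical
  obtain ⟨hne, hcov, hsep⟩ := hG
  obtain ⟨N, hN⟩ := packing d (lam * h) (3 * h) (by positivity)
  have hfin := (hN G (fun p => p.1) (fun i j hij => hsep _ i.2 _ j.2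
    (fun h => hij (Subtype.ext h))) y).1
  set T := hfin.toFinset with hT
  have hTm : ∀ p, p ∈ T ↔ dist p.1 y ≤ 3 * h := fun p => by simp [hT]
  have hclose : ∀ x, ∃ q : G, dist x q.1 < 3 / 2 * h := by
    intro x
    obtain ⟨q, hq, hd⟩ := (Metric.infDist_lt_iff hne (x := x) (r := 3 / 2 * h)).1
      (by linarith [hcov x])
    exact ⟨⟨q, hq⟩, hd⟩
  have hmem : y ∈ convexHull ℝ ((T.image (fun p : G => p.1) : Finset (Euc d)) : Set (Euc d)) := by
    by_contra hy
    obtain ⟨f, u, h1, h2⟩ := geometric_hahn_banach_point_closed (convex_convexHull ℝ _)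
      ((Finset.finite_toSet _).isClosed_convexHull (𝕜 := ℝ)) hy
    set ν := (InnerProductSpace.toDual ℝ (Euc d)).symm f with hν
    have hf : ∀ v, f v = inner ℝ ν v := fun v => by simp [hν]
    have hq2 : ∀ q : G, dist q.1 y ≤ 3 * h → f y < f q.1 := fun q hq =>
      h1.trans (h2 _ (subset_convexHull ℝ _ (by
        simp only [Finset.coe_image, mem_image, Finset.mem_coe]
        exact ⟨q, (hTm q).2 hq, rfl⟩)))
    by_cases h0 : ν = 0
    · obtain ⟨q, hq⟩ := hclose y
      have := hq2 q (by rw [dist_comm]; linarith)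
      simp [hf, h0] at this
    · have hνp : 0 < ‖ν‖ := norm_pos_iff.2 h0
      obtain ⟨q, hq⟩ := hclose (y - (3 / 2 * h / ‖ν‖) • ν)
      set x' := y - (3 / 2 * h / ‖ν‖) • ν with hx'
      have hdx : dist x' y = 3 / 2 * h := by
        rw [hx', dist_eq_norm, sub_sub_cancel_left, norm_neg, norm_smul, Real.norm_of_nonneg
          (by positivity)]
        field_simp
      have h3 := hq2 q (by
        have := dist_triangle_left q.1 y x'
        linarith)
      have h4 : f q.1 = f (q.1 - x') + f y - 3 / 2 * h * ‖ν‖ := by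
        have h6 : f x' = f y - 3 / 2 * h * ‖ν‖ := by
          rw [hx', map_sub, map_smul, hf ν, real_inner_self_eq_norm_sq, smul_eq_mul]
          field_simp
        rw [map_sub, h6]
        ring
      have h5 : f (q.1 - x') ≤ ‖ν‖ * (3 / 2 * h) := by
        rw [hf]
        refine (real_inner_le_norm _ _).trans ?_
        rw [← dist_eq_norm, dist_comm]
        gcongr
      linarith
  rw [Finset.mem_convexHull'] at hmem
  obtain ⟨w, hw0, hw1, hw2⟩ := hmem
  have hinj : Set.InjOn (fun p : G => p.1) (T : Set G) := fun a _ b _ hab => Subtype.ext hab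
  rw [Finset.sum_image hinj] at hw1 hw2
  refine ⟨T, fun p => w p.1, fun p hp => hw0 _ (Finset.mem_image_of_mem _ hp), hw1, hw2,
    fun p hp => ?_⟩
  rw [← dist_eq_norm]
  exact (hTm p).1 hp

/-- integer lattice points -/
def zpt {d : ℕ} (k : Fin d → ℤ) : Euc d := WithLp.toLp 2 (fun i => (k i : ℝ))

lemma zpt_add {d : ℕ} (k j : Fin d → ℤ) : zpt (k + j) = zpt k + zpt j := by
  ext i; simp [zpt]

lemma zpt_sep {d : ℕ} (k j : Fin d → ℤ) (hkj : k ≠ j) : 1 ≤ dist (zpt k) (zpt j) := by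
  obtain ⟨i, hi⟩ := Function.ne_iff.1 hkj
  have h1 : ‖(zpt k - zpt j) i‖ ≤ ‖zpt k - zpt j‖ := PiLp.norm_apply_le _ i
  rw [dist_eq_norm]
  refine le_trans ?_ h1
  have h2 : (1 : ℤ) ≤ |k i - j i| := Int.one_le_abs (sub_ne_zero.2 hi)
  have h3 : ((1 : ℤ) : ℝ) ≤ ((|k i - j i| : ℤ) : ℝ) := by exact_mod_cast h2
  simpa [zpt] using h3

lemma zpt_near {d : ℕ} (z : Euc d) : ∃ k, ‖z - zpt k‖ ≤ Real.sqrt d := by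
  refine ⟨fun i => ⌊z i⌋, ?_⟩
  rw [EuclideanSpace.norm_eq]
  apply Real.sqrt_le_sqrt
  have : ∀ i ∈ (Finset.univ : Finset (Fin d)),
      ‖(z - zpt fun i => ⌊z i⌋) i‖ ^ 2 ≤ (1 : ℝ) := by
    intro i _
    simp only [zpt, PiLp.sub_apply, Real.norm_eq_abs, sq_abs]
    have h1 := Int.floor_le (z i)
    have h2 := Int.lt_floor_add_one (z i)
    nlinarith
  refine (Finset.sum_le_sum this).trans ?_
  simp

lemma lattice_pou (d : ℕ) : ∃ (φ : Euc d → ℝ) (r : ℝ), 0 < r ∧ ContDiff ℝ 2 φ ∧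
    (∀ w, φ w ≠ 0 → ‖w‖ ≤ r) ∧ ∀ z, ∑ᶠ k, φ (z - zpt k) = 1 := by
  have hs : 0 ≤ Real.sqrt d := Real.sqrt_nonneg _
  let ψ : ContDiffBump (0 : Euc d) := ⟨Real.sqrt d + 1, Real.sqrt d + 2, by positivity, by linarith⟩
  have hψ : ∀ w, ψ w ≠ 0 → ‖w‖ ≤ Real.sqrt d + 2 := by
    intro w hw
    have : w ∈ Function.support ψ := hw
    rw [ψ.support_eq] at this
    simpa using (mem_ball.1 this).le
  have hψc : ContDiff ℝ 2 ψ := ψ.contDiff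
  obtain ⟨K, -, hK⟩ := bsum_bounds ψ hψc _ 1 one_pos hψ
  have hfin := fun x => bsum_finite one_pos hψ (zpt (d := d)) zpt_sep (fun _ => 1) x
  simp only [one_mul] at hfin
  set Ψ : Euc d → ℝ := bsum ψ zpt (fun _ => 1) with hΨ
  have hΨc : ContDiff ℝ 2 Ψ := (hK _ zpt zpt_sep (fun _ => 1)).1
  have hΨe : ∀ z, Ψ z = ∑ᶠ k, ψ (z - zpt k) := fun z => by simp [hΨ, bsum]
  have hpos : ∀ z, 0 < Ψ z := by
    intro z
    rw [hΨe]
    refine finsum_pos (fun k => ψ.nonneg) ?_ (hfin z)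
    obtain ⟨k, hk⟩ := zpt_near z
    refine ⟨k, ψ.pos_of_mem_ball ?_⟩
    simp only [mem_ball, dist_zero_right]
    show _ < Real.sqrt d + 2
    linarith
  have hper : ∀ z k, Ψ (z - zpt k) = Ψ z := by
    intro z k
    rw [hΨe, hΨe, ← finsum_comp_equiv (Equiv.addRight k) (f := fun j => ψ (z - zpt j))]
    refine finsum_congr fun j => ?_
    simp only [Equiv.coe_addRight, zpt_add]
    congr 1
    abel
  refine ⟨fun w => ψ w / Ψ w, Real.sqrt d + 2, by positivity, hψc.div hΨc fun x => (hpos x).ne',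
    fun w hw => hψ w fun h => hw (by simp [h]), fun z => ?_⟩
  simp only [hper, div_eq_mul_inv]
  rw [← finsum_mul, ← hΨe, mul_inv_cancel₀ (hpos z).ne']

lemma lattice_phi (d : ℕ) : ∃ (Φ : Euc d → ℝ) (r : ℝ), 0 < r ∧ ContDiff ℝ 2 Φ ∧
    (∀ w, Φ w ≠ 0 → ‖w‖ ≤ r) ∧ ∀ (a : ℝ) (ℓ : Euc d →L[ℝ] ℝ) (z : Euc d),
      bsum Φ zpt (fun k => a + ℓ (zpt k)) z = a + ℓ z := by
  obtain ⟨φ, r, hr, hφ, hsupp, hone⟩ := lattice_pou d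
  set e : Fin d → (Fin d → ℤ) := fun i => Pi.single i 1 with he
  have hen : ∀ i, ‖zpt (e i)‖ ≤ 1 := by
    intro i
    have : zpt (e i) = EuclideanSpace.single i (1 : ℝ) := by
      ext j
      by_cases hj : j = i
      · subst hj; simp [zpt, he]
      · simp [zpt, he, hj]
    rw [this]; simp
  have hexp : ∀ v : Euc d, v = ∑ i, v i • zpt (e i) := by
    intro v
    ext j
    simp [zpt, he, Pi.single_apply]
  refine ⟨fun w => φ w * (1 - ∑ i, w i) + ∑ i, φ (w + zpt (e i)) * (w i + 1), r + 1,
    by positivity, ?_, ?_, ?_⟩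
  · fun_prop
  · intro w hw
    by_contra hlt
    push Not at hlt
    apply hw
    have h0 : φ w = 0 := by
      by_contra h
      linarith [hsupp w h]
    have h1 : ∀ i, φ (w + zpt (e i)) = 0 := by
      intro i
      by_contra h
      have h2 := hsupp _ h
      have h3 := norm_sub_le (w + zpt (e i)) (zpt (e i))
      rw [add_sub_cancel_right] at h3
      linarith [hen i]
    simp [h0, h1]
  · intro a ℓ z
    have hfin : ∀ c : (Fin d → ℤ) → ℝ,
        (Function.support fun k => c k * φ (z - zpt k)).Finite :=
      fun c => bsum_finite one_pos hsupp zpt zpt_sep c z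
    set A : (Fin d → ℤ) → ℝ := fun k => a + ℓ (zpt k) with hA
    let g : Fin d → (Fin d → ℤ) → ℝ := fun i k => A (k + e i) * (z - zpt k) i * φ (z - zpt k)
    have hgfin : ∀ i, (Function.support (g i)).Finite := fun i => hfin _
    let g' : Fin d → (Fin d → ℤ) → ℝ := fun i k =>
      A k * (φ (z - zpt k + zpt (e i)) * ((z - zpt k) i + 1))
    have hgg : ∀ i, g i = g' i ∘ Equiv.addRight (e i) := by
      intro i
      funext k
      have h1 : z - (zpt k + zpt (e i)) + zpt (e i) = z - zpt k := by abel
      have h2 : (z - (zpt k + zpt (e i))) i + 1 = (z - zpt k) i := by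
        simp [zpt, he]
        ring
      simp only [g, g', Function.comp, Equiv.coe_addRight, zpt_add, h1, h2]
      ring
    have hg'fin : ∀ i, (Function.support (g' i)).Finite := by
      intro i
      have h1 := hgfin i
      rw [hgg i, Function.support_comp_eq_preimage] at h1
      have h2 := h1.image (Equiv.addRight (e i))
      rwa [Set.image_preimage_eq _ (Equiv.surjective _)] at h2
    have hgs : ∀ i, ∑ᶠ k, g' i k = ∑ᶠ k, g i k := by
      intro i
      rw [hgg i]
      exact (finsum_comp_equiv (Equiv.addRight (e i))).symm
    have hstart : bsum (fun w => φ w * (1 - ∑ i, w i) + ∑ i, φ (w + zpt (e i)) * (w i + 1))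
        zpt A z = ∑ᶠ k, (A k * (1 - ∑ i, (z - zpt k) i) * φ (z - zpt k) + ∑ i, g' i k) := by
      refine finsum_congr fun k => ?_
      simp only [g', ← Finset.mul_sum]
      ring
    have hsumfin : ∀ (q : Fin d → (Fin d → ℤ) → ℝ), (∀ i, (Function.support (q i)).Finite) →
        (Function.support fun k => ∑ i, q i k).Finite := by
      intro q hq
      refine (Set.finite_iUnion hq).subset ?_
      intro k hk
      by_contra h
      simp only [mem_iUnion, not_exists, Function.mem_support, not_not] at h
      exact hk (by simp [h])
    rw [hstart, finsum_add_distrib (hfin _) (hsumfin _ hg'fin),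
      finsum_sum_comm _ _ (fun i _ => hg'fin i)]
    rw [Finset.sum_congr rfl (fun i _ => hgs i),
      ← finsum_sum_comm Finset.univ (fun k i => g i k) (fun i _ => hgfin i),
      ← finsum_add_distrib (hfin _) (hsumfin _ hgfin)]
    have hlast : ∀ k, A k * (1 - ∑ i, (z - zpt k) i) * φ (z - zpt k) + ∑ i, g i k
        = (a + ℓ z) * φ (z - zpt k) := by
      intro k
      have h1 : ℓ z = ℓ (zpt k) + ∑ i, (z - zpt k) i * ℓ (zpt (e i)) := by
        have : ℓ (z - zpt k) = ∑ i, (z - zpt k) i * ℓ (zpt (e i)) := by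
          conv_lhs => rw [hexp (z - zpt k)]
          simp only [map_sum, map_smul, smul_eq_mul]
        rw [← this, map_sub]; ring
      have h2 : ∑ i, g i k = (A k * ∑ i, (z - zpt k) i +
          ∑ i, (z - zpt k) i * ℓ (zpt (e i))) * φ (z - zpt k) := by
        rw [Finset.mul_sum, ← Finset.sum_add_distrib, Finset.sum_mul]
        refine Finset.sum_congr rfl fun i _ => ?_
        simp only [g, hA, zpt_add, map_add]
        ring
      rw [h2, h1]
      simp only [hA]
      ring
    rw [finsum_congr hlast, ← mul_finsum, hone, mul_one]

lemma bsum_add {d : ℕ} {I : Type} {Φ : Euc d → ℝ} {r μ : ℝ} (hμ : 0 < μ)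
    (hr : ∀ w, Φ w ≠ 0 → ‖w‖ ≤ r)
    (z : I → Euc d) (hz : ∀ i j, i ≠ j → μ ≤ dist (z i) (z j)) (c c' : I → ℝ) (x : Euc d) :
    bsum Φ z (fun i => c i + c' i) x = bsum Φ z c x + bsum Φ z c' x := by
  simp only [bsum, add_mul]
  exact finsum_add_distrib (bsum_finite hμ hr z hz c x) (bsum_finite hμ hr z hz c' x)

lemma bsum_mul {d : ℕ} {I : Type} (Φ : Euc d → ℝ) (z : I → Euc d) (a : ℝ) (c : I → ℝ)
    (x : Euc d) : bsum Φ z (fun i => a * c i) x = a * bsum Φ z c x := by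
  simp only [bsum, mul_assoc]
  rw [mul_finsum]

lemma taylor_ball {d : ℕ} {u : Euc d → ℝ} (hu : ContDiff ℝ 1 u) {x y : Euc d} {s b : ℝ}
    (hb : ∀ y, ‖y - x‖ ≤ s → ‖fderiv ℝ u y - fderiv ℝ u x‖ ≤ b) (hy : ‖y - x‖ ≤ s) :
    |u y - u x - fderiv ℝ u x (y - x)| ≤ b * ‖y - x‖ := by
  have hs : 0 ≤ s := (norm_nonneg _).trans hy
  have := (convex_closedBall x s).norm_image_sub_le_of_norm_fderiv_le' (𝕜 := ℝ) (f := u) (C := b)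
    (φ := fderiv ℝ u x) (x := x) (y := y)
    (fun w _ => (hu.differentiable (by norm_num)) w)
    (fun w hw => hb w (by simpa [dist_eq_norm] using hw)) (mem_closedBall_self hs)
    (by simpa [dist_eq_norm] using hy)
  simpa using this

lemma core (d : ℕ) (lam : ℝ) (hlam : 0 < lam) : ∃ K ρ : ℝ, 0 < K ∧ 1 ≤ ρ ∧
    ∀ h : ℝ, 0 < h → ∀ G : Set (Euc d), IsNet h lam G →
    ∃ Ext : (G → ℝ) → (Euc d → ℝ),
      (∀ g₁ g₂ : G → ℝ, ∀ x, Ext (fun p => g₁ p + g₂ p) x = Ext g₁ x + Ext g₂ x) ∧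
      (∀ (c : ℝ) (g : G → ℝ), ∀ x, Ext (fun p => c * g p) x = c * Ext g x) ∧
      (∀ g : G → ℝ, ∀ p : G, Ext g p.1 = g p) ∧
      (∀ u : Euc d → ℝ, ContDiff ℝ 1 u → ∀ b : ℝ, 0 ≤ b →
        (∀ x y, ‖y - x‖ ≤ ρ * h → ‖fderiv ℝ u y - fderiv ℝ u x‖ ≤ b) →
        ContDiff ℝ 1 (Ext fun p => u p.1) ∧
        (∀ x, |Ext (fun p => u p.1) x - u x| ≤ K * (b * h)) ∧
        (∀ x, ‖fderiv ℝ (Ext fun p => u p.1) x - fderiv ℝ u x‖ ≤ K * b) ∧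
        (∀ x y, ‖y - x‖ ≤ h → ‖fderiv ℝ (Ext fun p => u p.1) y
          - fderiv ℝ (Ext fun p => u p.1) x‖ ≤ K * b * (‖y - x‖ / h))) := by
  obtain ⟨Φ, r, hr, hΦ, hΦs, hΦa⟩ := lattice_phi d
  obtain ⟨K1, hK1, H1⟩ := bsum_scaled Φ hΦ r 1 one_pos hΦs
  let ψ : ContDiffBump (0 : Euc d) := ⟨lam / 4, lam / 2, by positivity, by linarith⟩
  have hψ : ∀ w, ψ w ≠ 0 → ‖w‖ ≤ lam / 2 := by
    intro w hw
    have : w ∈ Function.support ψ := hw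
    rw [ψ.support_eq] at this
    simpa using (mem_ball.1 this).le
  have hψ0 : ψ 0 = 1 := ψ.one_of_mem_closedBall (mem_closedBall_self (by positivity))
  have hψc : ContDiff ℝ 2 ψ := ψ.contDiff
  obtain ⟨K2, hK2, H2⟩ := bsum_scaled ψ hψc (lam / 2) lam hlam hψ
  set ρ := r + 5 with hρ
  have hρ0 : 0 < ρ := by positivity
  refine ⟨K1 * ρ + K2 * (K1 * ρ), ρ, by positivity, by linarith, fun h hh G hG => ?_⟩
  choose T w hw0 hw1 hw2 hw3 using fun k : Fin d → ℤ => net_hull hh hlam hG (h • zpt k)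
  let c : (G → ℝ) → (Fin d → ℤ) → ℝ := fun g k => ∑ p ∈ T k, w k p * g p
  let S : (G → ℝ) → Euc d → ℝ := fun g x => bsum Φ zpt (c g) (h⁻¹ • x)
  let zG : G → Euc d := fun p => h⁻¹ • p.1
  have hzG : ∀ i j, i ≠ j → lam ≤ dist (zG i) (zG j) := by
    intro i j hij
    have := hG.2.2 _ i.2 _ j.2 (fun h => hij (Subtype.ext h))
    simp only [zG]
    rw [dist_smul₀, norm_inv, Real.norm_of_nonneg hh.le, inv_mul_eq_div, le_div_iff₀ hh]
    exact this
  let e : (G → ℝ) → G → ℝ := fun g p => g p - S g p.1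
  let H : (G → ℝ) → Euc d → ℝ := fun g x => bsum ψ zG (e g) (h⁻¹ • x)
  have hSadd : ∀ g₁ g₂ x, S (fun p => g₁ p + g₂ p) x = S g₁ x + S g₂ x := by
    intro g₁ g₂ x
    simp only [S]
    rw [← bsum_add one_pos hΦs zpt zpt_sep]
    congr 1
    funext k
    simp only [c, mul_add, Finset.sum_add_distrib]
  have hSmul : ∀ (a : ℝ) g x, S (fun p => a * g p) x = a * S g x := by
    intro a g x
    simp only [S]
    rw [← bsum_mul]
    congr 1
    funext k
    simp only [c, Finset.mul_sum]
    exact Finset.sum_congr rfl fun p _ => by ring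
  have hHadd : ∀ g₁ g₂ x, H (fun p => g₁ p + g₂ p) x = H g₁ x + H g₂ x := by
    intro g₁ g₂ x
    simp only [H]
    rw [← bsum_add hlam hψ zG hzG]
    congr 1
    funext p
    simp only [e, hSadd]
    ring
  have hHmul : ∀ (a : ℝ) g x, H (fun p => a * g p) x = a * H g x := by
    intro a g x
    simp only [H]
    rw [← bsum_mul]
    congr 1
    funext p
    simp only [e, hSmul]
    ring
  refine ⟨fun g x => S g x + H g x, ?_, ?_, ?_, ?_⟩
  · intro g₁ g₂ x
    simp only [hSadd, hHadd]
    ring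
  · intro a g x
    simp only [hSmul, hHmul]
    ring
  · intro g p
    have : H g p.1 = e g p := by
      simp only [H, bsum]
      rw [finsum_eq_single _ p]
      · simp [zG, hψ0]
      · intro q hq
        have : ψ (h⁻¹ • p.1 - zG q) = 0 := by
          by_contra hne
          have h1 := hψ _ hne
          have h2 := hzG p q hq.symm
          rw [dist_eq_norm] at h2
          simp only [zG] at h1 h2
          linarith
        rw [this, mul_zero]
    simp only [this, e]
    ring
  · intro u hu b hb hub
    have hSu : ∀ x, ContDiff ℝ 2 (S fun p => u p.1) ∧
        |S (fun p => u p.1) x - u x| ≤ K1 * ρ * (b * h) ∧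
        ‖fderiv ℝ (S fun p => u p.1) x - fderiv ℝ u x‖ ≤ K1 * ρ * b ∧
        ∀ y, ‖y - x‖ ≤ h → ‖fderiv ℝ (S fun p => u p.1) y
          - fderiv ℝ (S fun p => u p.1) x‖ ≤ K1 * ρ * b * (‖y - x‖ / h) := by
      intro x
      set ℓ := fderiv ℝ u x with hℓ
      let c' : (Fin d → ℤ) → ℝ := fun k =>
        c (fun p => u p.1) k - ((u x - ℓ x) + (h • ℓ) (zpt k))
      obtain ⟨F1, F2⟩ := H1 _ zpt zpt_sep c' h hh
      set F : Euc d → ℝ := fun y => bsum Φ zpt c' (h⁻¹ • y) with hF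
      have hSF : (S fun p => u p.1) = fun y => F y + ((u x - ℓ x) + ℓ y) := by
        funext y
        have h1 : (u x - ℓ x) + ℓ y = (u x - ℓ x) + (h • ℓ) (h⁻¹ • y) := by
          simp [hh.ne']
        rw [h1, ← hΦa, hF]
        simp only [S]
        rw [← bsum_add one_pos hΦs zpt zpt_sep]
        congr 1
        funext k
        simp only [c']
        ring
      have hFd : ∀ y, fderiv ℝ (S fun p => u p.1) y = fderiv ℝ F y + ℓ := by
        intro y
        rw [hSF, fderiv_fun_add ((F1.differentiable (by norm_num)) y) (by fun_prop),
          fderiv_const_add, ContinuousLinearMap.fderiv]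
      obtain ⟨E1, E2, E3⟩ := F2 x (b * (ρ * h)) (by positivity) (by
        intro k hk
        have h1 : c' k = ∑ p ∈ T k, w k p * (u p.1 - u x - ℓ (p.1 - x)) := by
          have h2 : (h • ℓ) (zpt k) = ∑ p ∈ T k, w k p * ℓ p.1 := by
            have : (h • ℓ) (zpt k) = ℓ (h • zpt k) := by simp
            rw [this, ← hw2 k, map_sum]
            simp only [map_smul, smul_eq_mul]
          have h3 : u x - ℓ x = ∑ p ∈ T k, w k p * (u x - ℓ x) := by
            rw [← Finset.sum_mul, hw1, one_mul]
          simp only [c', c]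
          rw [h2, h3, ← Finset.sum_add_distrib, ← Finset.sum_sub_distrib]
          refine Finset.sum_congr rfl fun p _ => ?_
          rw [map_sub]
          ring
        rw [h1]
        refine (Finset.abs_sum_le_sum_abs _ _).trans ?_
        have h4 : ∀ p ∈ T k, |w k p * (u p.1 - u x - ℓ (p.1 - x))| ≤ w k p * (b * (ρ * h)) := by
          intro p hp
          rw [abs_mul, abs_of_nonneg (hw0 k p hp)]
          have h5 : ‖p.1 - x‖ ≤ ρ * h := by
            have h6 := hw3 k p hp
            have h7 := norm_add_le (p.1 - h • zpt k) (h • zpt k - x)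
            rw [sub_add_sub_cancel] at h7
            rw [hρ]
            linarith
          refine mul_le_mul_of_nonneg_left ?_ (hw0 k p hp)
          refine (taylor_ball hu (hub x) h5).trans ?_
          gcongr
        refine (Finset.sum_le_sum h4).trans ?_
        rw [← Finset.sum_mul, hw1, one_mul])
      have hdiv : b * (ρ * h) / h = ρ * b := by field_simp
      rw [hdiv] at E2 E3
      refine ⟨?_, ?_, ?_, ?_⟩
      · rw [hSF]
        fun_prop
      · have : S (fun p => u p.1) x - u x = F x := by rw [hSF]; ring
        rw [this]
        refine E1.trans_eq (by ring)
      · rw [hFd, add_sub_cancel_right]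
        refine E2.trans_eq (by ring)
      · intro y hy
        rw [hFd, hFd, add_sub_add_right_eq_sub]
        refine (E3 y hy).trans_eq (by ring)
    obtain ⟨J1, J2⟩ := H2 _ zG hzG (e fun p => u p.1) h hh
    have J3 := fun x => J2 x (K1 * ρ * (b * h)) (by positivity) (fun p _ => by
      have := (hSu p.1).2.1
      rw [abs_sub_comm] at this
      exact this)
    have hSd : ∀ x, DifferentiableAt ℝ (S fun p => u p.1) x := fun x =>
      (hSu x).1.differentiable (by norm_num) x
    have hHc : ContDiff ℝ 2 (H fun p => u p.1) := J1
    have hHd : ∀ x, DifferentiableAt ℝ (H fun p => u p.1) x := fun x =>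
      hHc.differentiable (by norm_num) x
    have hfd : ∀ x, fderiv ℝ (fun x => S (fun p => u p.1) x + H (fun p => u p.1) x) x
        = fderiv ℝ (S fun p => u p.1) x + fderiv ℝ (H fun p => u p.1) x := fun x =>
      fderiv_fun_add (hSd x) (hHd x)
    have hdiv : K1 * ρ * (b * h) / h = K1 * ρ * b := by field_simp
    refine ⟨?_, ?_, ?_, ?_⟩
    · exact ((hSu 0).1.add hHc).of_le (by norm_num)
    · intro x
      have h1 := (hSu x).2.1
      have h2 : |H (fun p => u p.1) x| ≤ _ := (J3 x).1
      have h3 := abs_add_le (S (fun p => u p.1) x - u x) (H (fun p => u p.1) x)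
      rw [show S (fun p => u p.1) x + H (fun p => u p.1) x - u x
        = S (fun p => u p.1) x - u x + H (fun p => u p.1) x by ring]
      nlinarith
    · intro x
      rw [hfd]
      have h1 := (hSu x).2.2.1
      have h2 : ‖fderiv ℝ (H fun p => u p.1) x‖ ≤ _ := (J3 x).2.1
      rw [hdiv] at h2
      have h3 := norm_add_le (fderiv ℝ (S fun p => u p.1) x - fderiv ℝ u x)
        (fderiv ℝ (H fun p => u p.1) x)
      rw [sub_add_eq_add_sub] at h3
      nlinarith
    · intro x y hy
      rw [hfd, hfd, add_sub_add_comm]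
      have h1 := (hSu x).2.2.2 y hy
      have h2 : ‖fderiv ℝ (H fun p => u p.1) y - fderiv ℝ (H fun p => u p.1) x‖ ≤ _ :=
        (J3 x).2.2 y hy
      rw [hdiv] at h2
      refine (norm_add_le _ _).trans ((add_le_add h1 h2).trans_eq ?_)
      ring

lemma C1HolderNorm_le {d : ℕ} {γ : ℝ} {v : Euc d → ℝ} {a b c : ℝ} (ha : ∀ x, |v x| ≤ a)
    (hb : ∀ x, ‖fderiv ℝ v x‖ ≤ b) (hc : 0 ≤ c)
    (hh : ∀ x y, ‖fderiv ℝ v x - fderiv ℝ v y‖ ≤ c * ‖x - y‖ ^ γ) :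
    C1HolderNorm γ v ≤ a + b + c := by
  have h1 : supNorm v ≤ a := ciSup_le ha
  have h2 : gradSup v ≤ b := ciSup_le hb
  have h3 : gradHolderSemi γ v ≤ c := csInf_le ⟨0, fun M hM => hM.1⟩ ⟨hc, hh⟩
  simp only [C1HolderNorm]
  linarith

lemma IsC1Holder.bounds {d : ℕ} {γ : ℝ} (hγ : 0 < γ) {u : Euc d → ℝ} (hu : IsC1Holder γ u) :
    0 ≤ C1HolderNorm γ u ∧ (∀ x, |u x| ≤ C1HolderNorm γ u) ∧
    (∀ x, ‖fderiv ℝ u x‖ ≤ C1HolderNorm γ u) ∧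
    ∀ x y, ‖fderiv ℝ u x - fderiv ℝ u y‖ ≤ C1HolderNorm γ u * ‖x - y‖ ^ γ := by
  obtain ⟨-, ⟨M, hM⟩, M', hM'⟩ := hu
  have h1 : ∀ x, |u x| ≤ supNorm u := fun x =>
    le_ciSup (f := fun x => |u x|) ⟨M, by rintro _ ⟨x, rfl⟩; exact (hM x).1⟩ x
  have h2 : ∀ x, ‖fderiv ℝ u x‖ ≤ gradSup u := fun x =>
    le_ciSup (f := fun x => ‖fderiv ℝ u x‖) ⟨M, by rintro _ ⟨x, rfl⟩; exact (hM x).2⟩ x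
  have hne : {M : ℝ | 0 ≤ M ∧ ∀ x y, ‖fderiv ℝ u x - fderiv ℝ u y‖ ≤ M * ‖x - y‖ ^ γ}.Nonempty := by
    refine ⟨max M' 0, le_max_right _ _, fun x y => (hM' x y).trans ?_⟩
    gcongr
    exact le_max_left _ _
  have h3 : 0 ≤ gradHolderSemi γ u := le_csInf hne fun M hM => hM.1
  have h4 : ∀ x y, ‖fderiv ℝ u x - fderiv ℝ u y‖ ≤ gradHolderSemi γ u * ‖x - y‖ ^ γ := by
    intro x y
    by_cases hxy : x = y
    · subst hxy
      simp [Real.zero_rpow hγ.ne']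
    · have hp : 0 < ‖x - y‖ ^ γ := Real.rpow_pos_of_pos (norm_pos_iff.2 (sub_ne_zero.2 hxy)) _
      rw [← div_le_iff₀ hp]
      refine le_csInf hne fun M hM => ?_
      rw [div_le_iff₀ hp]
      exact hM.2 x y
  have p1 := (abs_nonneg _).trans (h1 0)
  have p2 := (norm_nonneg _).trans (h2 0)
  simp only [C1HolderNorm]
  refine ⟨by linarith, fun x => by linarith [h1 x], fun x => by linarith [h2 x], fun x y => ?_⟩
  refine (h4 x y).trans ?_
  gcongr
  linarith

lemma IsC2b.bounds {d : ℕ} {u : Euc d → ℝ} (hu : IsC2b u) :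
    0 ≤ C2Norm u ∧ (∀ x, |u x| ≤ C2Norm u) ∧
    ∀ x y, ‖fderiv ℝ u x - fderiv ℝ u y‖ ≤ C2Norm u * ‖x - y‖ := by
  obtain ⟨hc, M, hM⟩ := hu
  have h1 : ∀ x, |u x| ≤ supNorm u := fun x =>
    le_ciSup (f := fun x => |u x|) ⟨M, by rintro _ ⟨x, rfl⟩; exact (hM x).1⟩ x
  have h2 : ∀ x, ‖fderiv ℝ u x‖ ≤ gradSup u := fun x =>
    le_ciSup (f := fun x => ‖fderiv ℝ u x‖) ⟨M, by rintro _ ⟨x, rfl⟩; exact (hM x).2.1⟩ x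
  have h3 : ∀ x, ‖iteratedFDeriv ℝ 2 u x‖ ≤ hessSup u := fun x =>
    le_ciSup (f := fun x => ‖iteratedFDeriv ℝ 2 u x‖)
      ⟨M, by rintro _ ⟨x, rfl⟩; exact (hM x).2.2⟩ x
  have p1 := (abs_nonneg _).trans (h1 0)
  have p2 := (norm_nonneg _).trans (h2 0)
  have p3 := (norm_nonneg _).trans (h3 0)
  have hD : ContDiff ℝ 1 (fderiv ℝ u) := hc.fderiv_right (by norm_num)
  have h4 : ∀ x, ‖fderiv ℝ (fderiv ℝ u) x‖ ≤ hessSup u := fun x => by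
    have e1 : ‖iteratedFDeriv ℝ 1 (fderiv ℝ u) x‖ = ‖iteratedFDeriv ℝ 2 u x‖ :=
      norm_iteratedFDeriv_fderiv
    rw [norm_iteratedFDeriv_one] at e1
    rw [e1]
    exact h3 x
  simp only [C2Norm]
  refine ⟨by linarith, fun x => by linarith [h1 x], fun x y => ?_⟩
  have := (convex_univ (𝕜 := ℝ) (E := Euc d)).norm_image_sub_le_of_norm_fderiv_le (𝕜 := ℝ)
    (f := fderiv ℝ u) (C := hessSup u) (x := y) (y := x)
    (fun w _ => (hD.differentiable (by norm_num)) w) (fun w _ => h4 w) (mem_univ _) (mem_univ _)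
  refine this.trans ?_
  gcongr
  linarith

lemma IsC3b.c2 {d : ℕ} {u : Euc d → ℝ} (hu : IsC3b u) : IsC2b u ∧ C2Norm u ≤ C3Norm u := by
  obtain ⟨hc, hM⟩ := hu
  obtain ⟨M0, h0⟩ := hM 0 (by norm_num)
  obtain ⟨M1, h1⟩ := hM 1 (by norm_num)
  obtain ⟨M2, h2⟩ := hM 2 (by norm_num)
  obtain ⟨M3, h3⟩ := hM 3 (by norm_num)
  have e0 : ∀ x, ‖iteratedFDeriv ℝ 0 u x‖ = |u x| := fun x => by
    rw [norm_iteratedFDeriv_zero, Real.norm_eq_abs]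
  have e1 : ∀ x, ‖iteratedFDeriv ℝ 1 u x‖ = ‖fderiv ℝ u x‖ := fun x => norm_iteratedFDeriv_one _
  constructor
  · refine ⟨hc.of_le (by norm_num), max M0 (max M1 M2), fun x => ⟨?_, ?_, ?_⟩⟩
    · rw [← e0]
      exact (h0 x).trans (le_max_left _ _)
    · rw [← e1]
      exact (h1 x).trans ((le_max_left _ _).trans (le_max_right _ _))
    · exact (h2 x).trans ((le_max_right _ _).trans (le_max_right _ _))
  · have h4 : 0 ≤ ⨆ x, ‖iteratedFDeriv ℝ 3 u x‖ := Real.iSup_nonneg fun x => norm_nonneg _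
    simp only [C2Norm, C3Norm, Finset.sum_range_succ, Finset.sum_range_zero, supNorm, gradSup,
      hessSup, e0, e1]
    linarith

/-- scale-`h` control of a function and of its gradient -/
def Good {d : ℕ} (h A : ℝ) (v : Euc d → ℝ) : Prop :=
  ContDiff ℝ 1 v ∧ (∀ x, |v x| ≤ A * h) ∧ (∀ x, ‖fderiv ℝ v x‖ ≤ A * h) ∧
    ∀ x y, ‖x - y‖ ≤ h → ‖fderiv ℝ v x - fderiv ℝ v y‖ ≤ A * ‖x - y‖

lemma Good.sub {d : ℕ} {h A B : ℝ} {v w : Euc d → ℝ} (hv : Good h A v) (hw : Good h B w) :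
    Good h (A + B) (fun x => v x - w x) := by
  obtain ⟨a1, a2, a3, a4⟩ := hv
  obtain ⟨b1, b2, b3, b4⟩ := hw
  have hfd : ∀ x, fderiv ℝ (fun x => v x - w x) x = fderiv ℝ v x - fderiv ℝ w x := fun x =>
    fderiv_fun_sub (a1.differentiable (by norm_num) x) (b1.differentiable (by norm_num) x)
  refine ⟨a1.sub b1, fun x => ?_, fun x => ?_, fun x y hxy => ?_⟩
  · refine (abs_sub _ _).trans ?_
    rw [add_mul]
    exact add_le_add (a2 x) (b2 x)
  · rw [hfd]
    refine (norm_sub_le _ _).trans ?_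
    rw [add_mul]
    exact add_le_add (a3 x) (b3 x)
  · rw [hfd, hfd, sub_sub_sub_comm]
    refine (norm_sub_le _ _).trans ?_
    rw [add_mul]
    exact add_le_add (a4 x y hxy) (b4 x y hxy)

lemma Good.norm {d : ℕ} {h A γ : ℝ} {v : Euc d → ℝ} (hv : Good h A v) (hh : 0 < h) (hh1 : h ≤ 1)
    (hγ : 0 < γ) (hγ1 : γ < 1) :
    IsC1Holder γ v ∧ C1HolderNorm γ v ≤ 4 * A * h ^ (1 - γ) := by
  obtain ⟨a1, a2, a3, a4⟩ := hv
  have hA : 0 ≤ A := by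
    have := (abs_nonneg _).trans (a2 0)
    exact nonneg_of_mul_nonneg_left this hh
  have hpw : h ≤ h ^ (1 - γ) := by
    have := Real.rpow_le_rpow_of_exponent_ge hh hh1 (show 1 - γ ≤ 1 by linarith)
    rwa [Real.rpow_one] at this
  have hp0 : 0 ≤ h ^ (1 - γ) := Real.rpow_nonneg hh.le _
  have hmul : ∀ t : ℝ, 0 < t → t ^ (1 - γ) * t ^ γ = t := fun t ht => by
    rw [← Real.rpow_add ht]; simp
  have hH : ∀ x y, ‖fderiv ℝ v x - fderiv ℝ v y‖ ≤ 2 * A * h ^ (1 - γ) * ‖x - y‖ ^ γ := by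
    intro x y
    rcases (norm_nonneg (x - y)).eq_or_lt with h0 | h0
    · have : x = y := sub_eq_zero.1 (norm_eq_zero.1 h0.symm)
      subst this
      simp [Real.zero_rpow hγ.ne']
    have hq0 : 0 ≤ ‖x - y‖ ^ γ := Real.rpow_nonneg h0.le _
    rcases le_total ‖x - y‖ h with h1 | h1
    · have h2 : ‖x - y‖ ≤ h ^ (1 - γ) * ‖x - y‖ ^ γ := by
        calc ‖x - y‖ = ‖x - y‖ ^ (1 - γ) * ‖x - y‖ ^ γ := (hmul _ h0).symm
          _ ≤ _ := by
            gcongr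
      have h3 := a4 x y h1
      have h4 : A * ‖x - y‖ ≤ A * (h ^ (1 - γ) * ‖x - y‖ ^ γ) := by gcongr
      have h5 : 0 ≤ A * (h ^ (1 - γ) * ‖x - y‖ ^ γ) := by positivity
      nlinarith
    · have h2 : h ≤ h ^ (1 - γ) * ‖x - y‖ ^ γ := by
        calc h = h ^ (1 - γ) * h ^ γ := (hmul _ hh).symm
          _ ≤ _ := by gcongr
      have h3 := norm_sub_le (fderiv ℝ v x) (fderiv ℝ v y)
      have h4 : A * h ≤ A * (h ^ (1 - γ) * ‖x - y‖ ^ γ) := by gcongr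
      nlinarith [a3 x, a3 y]
  refine ⟨⟨a1, ⟨A * h, fun x => ⟨a2 x, a3 x⟩⟩, _, hH⟩, ?_⟩
  refine (C1HolderNorm_le a2 a3 (by positivity) hH).trans ?_
  have : A * h ≤ A * h ^ (1 - γ) := by gcongr
  nlinarith

lemma smooth_bounds {d : ℕ} {F : Type} [NormedAddCommGroup F] [NormedSpace ℝ F] (f : Euc d → F)
    (hf : ContDiff ℝ 2 f) (hcs : HasCompactSupport f) : ∃ B : ℝ, 0 < B ∧ (∀ x, ‖f x‖ ≤ B) ∧
      (∀ x, ‖fderiv ℝ f x‖ ≤ B) ∧ ∀ x y, ‖fderiv ℝ f x - fderiv ℝ f y‖ ≤ B * ‖x - y‖ := by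
  have hD : ContDiff ℝ 1 (fderiv ℝ f) := hf.fderiv_right (by norm_num)
  obtain ⟨B0, hB0⟩ := hcs.exists_bound_of_continuous hf.continuous
  obtain ⟨B1, hB1⟩ := (hcs.fderiv ℝ).exists_bound_of_continuous hD.continuous
  obtain ⟨L, hL⟩ := hD.lipschitzWith_of_hasCompactSupport (hcs.fderiv ℝ) (by norm_num)
  have hL0 : (0 : ℝ) ≤ L := L.2
  have q0 := (norm_nonneg _).trans (hB0 0)
  have q1 := (norm_nonneg _).trans (hB1 0)
  refine ⟨B0 + B1 + L + 1, by positivity, fun x => by linarith [hB0 x],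
    fun x => by linarith [hB1 x], fun x y => ?_⟩
  have := hL.dist_le_mul x y
  rw [dist_eq_norm, dist_eq_norm] at this
  refine this.trans ?_
  gcongr
  linarith

lemma grad_sq {d : ℕ} {u : Euc d → ℝ} {M m : ℝ} (hM : 0 < M)
    (hT : ∀ x y, |u y - u x - fderiv ℝ u x (y - x)| ≤ M * ‖y - x‖ ^ 2) (hm : ∀ x, m ≤ u x)
    (x : Euc d) : ‖fderiv ℝ u x‖ ^ 2 ≤ 4 * M * (u x - m) := by
  set ν := (InnerProductSpace.toDual ℝ (Euc d)).symm (fderiv ℝ u x) with hν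
  have hf : ∀ v, fderiv ℝ u x v = inner ℝ ν v := fun v => by simp [hν]
  have hn : ‖fderiv ℝ u x‖ = ‖ν‖ := by simp [hν]
  rw [hn]
  have h1 := hT x (x - (1 / (2 * M)) • ν)
  rw [sub_sub_cancel_left, map_neg, map_smul, hf, real_inner_self_eq_norm_sq, norm_neg, norm_smul,
    Real.norm_of_nonneg (by positivity), smul_eq_mul, mul_pow] at h1
  have h2 := hm (x - (1 / (2 * M)) • ν)
  have h3 := (abs_le.1 h1).2
  have h4 : m - u x + 1 / (2 * M) * ‖ν‖ ^ 2 ≤ M * ((1 / (2 * M)) ^ 2 * ‖ν‖ ^ 2) := by linarith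
  have h5 : M * ((1 / (2 * M)) ^ 2 * ‖ν‖ ^ 2) = ‖ν‖ ^ 2 / (4 * M) := by field_simp; ring
  have h6 : 1 / (2 * M) * ‖ν‖ ^ 2 = 2 * (‖ν‖ ^ 2 / (4 * M)) := by field_simp; ring
  rw [h5, h6] at h4
  have h7 : ‖ν‖ ^ 2 / (4 * M) ≤ u x - m := by linarith
  rw [div_le_iff₀ (by positivity)] at h7
  linarith

lemma cutoff (d : ℕ) : ∃ χ : Euc d → ℝ, ContDiff ℝ 2 χ ∧ HasCompactSupport χ ∧ χ 0 = 1 ∧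
    (∀ x, 0 ≤ χ x) ∧ ∀ x, χ x ≤ 1 := by
  let χ : ContDiffBump (0 : Euc d) := ⟨1, 2, by norm_num, by norm_num⟩
  exact ⟨χ, χ.contDiff, χ.hasCompactSupport,
    χ.one_of_mem_closedBall (mem_closedBall_self (by positivity)), fun _ => χ.nonneg,
    fun _ => χ.le_one⟩

set_option maxHeartbeats 800000 in
lemma corrector (d : ℕ) : ∃ CR : ℝ, 0 < CR ∧ ∀ (h lam : ℝ) (G : Set (Euc d)), 0 < h → h ≤ 1 →
    IsNet h lam G → ∀ (u : Euc d → ℝ) (M : ℝ), ContDiff ℝ 1 u → 0 ≤ M → (∀ x, |u x| ≤ M) →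
    (∀ x y, ‖fderiv ℝ u x - fderiv ℝ u y‖ ≤ M * ‖x - y‖) → (∀ p : G, 0 ≤ u p.1) →
    ∀ x₀, u x₀ = 0 → ∃ R : Euc d → ℝ, Good h (CR * M) R ∧ R x₀ = 0 ∧ ∀ x, 0 ≤ u x + R x := by
  obtain ⟨χ, hχc, hχs, hχ0, hχn, hχ1⟩ := cutoff d
  have hVc : ContDiff ℝ 2 (fun z : Euc d => χ z • z) := hχc.smul contDiff_id
  have hWc : ContDiff ℝ 2 (fun z : Euc d => χ z * (‖z‖ ^ 2 - 9)) :=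
    (hχc.mul ((contDiff_norm_sq ℝ).sub contDiff_const))
  have hVs : HasCompactSupport (fun z : Euc d => χ z • z) := hχs.smul_right
  have hWs : HasCompactSupport (fun z : Euc d => χ z * (‖z‖ ^ 2 - 9)) := hχs.mul_right
  obtain ⟨B1, hB1, V1, V2, V3⟩ := smooth_bounds _ hVc hVs
  obtain ⟨B2, hB2, W1, W2, W3⟩ := smooth_bounds _ hWc hWs
  set V := (fun z : Euc d => χ z • z) with hV
  set W := (fun z : Euc d => χ z * (‖z‖ ^ 2 - 9)) with hW
  refine ⟨9 + B2 + 6 * B1, by positivity, fun h lam G hh hh1 hG u M hu hM huM hL hpos x₀ hx₀ => ?_⟩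
  rcases hM.eq_or_lt with h0 | hMp
  · refine ⟨fun _ => 0, ?_, rfl, fun x => ?_⟩
    · subst h0
      refine ⟨contDiff_const, by simp, by simp, by simp⟩
    · have := huM x
      rw [← h0] at this
      simp [abs_nonpos_iff.1 this]
  have hT : ∀ x y, |u y - u x - fderiv ℝ u x (y - x)| ≤ M * ‖y - x‖ ^ 2 := by
    intro x y
    have := taylor_ball hu (x := x) (y := y) (s := ‖y - x‖) (b := M * ‖y - x‖) (fun w hw =>
      (hL w x).trans (by gcongr)) le_rfl
    refine this.trans_eq (by ring)
  -- lower bound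
  have hbd : BddBelow (range u) := ⟨-M, by rintro _ ⟨x, rfl⟩; exact (abs_le.1 (huM x)).1⟩
  set m := ⨅ x, u x with hm
  have hmu : ∀ x, m ≤ u x := fun x => ciInf_le hbd x
  have hlow : -(9 * M * h ^ 2) ≤ m := by
    obtain ⟨x, hx⟩ := exists_lt_of_ciInf_lt (show ⨅ x, u x < m + M * h ^ 2 by
      have : 0 < M * h ^ 2 := by positivity
      linarith)
    have h1 := grad_sq hMp hT hmu x
    have h2 : ‖fderiv ℝ u x‖ ≤ 2 * M * h := by
      refine abs_le_of_sq_le_sq' (a := ‖fderiv ℝ u x‖) ?_ (by positivity) |>.2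
      nlinarith
    obtain ⟨q, hq, hd⟩ := (Metric.infDist_lt_iff hG.1 (x := x) (r := 2 * h)).1
      (by linarith [hG.2.1 x])
    have h3 := hpos ⟨q, hq⟩
    have h4 := (abs_le.1 (hT x q)).2
    rw [dist_comm, dist_eq_norm] at hd
    have h5 : fderiv ℝ u x (q - x) ≤ 2 * M * h * (2 * h) := by
      refine (le_abs_self _).trans ?_
      rw [← Real.norm_eq_abs]
      refine ((fderiv ℝ u x).le_opNorm _).trans ?_
      gcongr
    have h6 : M * ‖q - x‖ ^ 2 ≤ M * (2 * h) ^ 2 := by gcongr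
    simp only at h3
    nlinarith
  set P := fderiv ℝ u x₀ with hP
  have hPn : ‖P‖ ≤ 6 * M * h := by
    have h1 := grad_sq hMp hT hmu x₀
    rw [hx₀] at h1
    refine abs_le_of_sq_le_sq' (a := ‖P‖) ?_ (by positivity) |>.2
    nlinarith
  set q : Euc d →L[ℝ] ℝ := (M * h)⁻¹ • P with hq
  have hqn : ‖q‖ ≤ 6 := by
    rw [hq, norm_smul, norm_inv, Real.norm_of_nonneg (by positivity), inv_mul_le_iff₀
      (by positivity)]
    linarith
  let Q : Euc d → ℝ := fun z => W z - q (V z)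
  have hQc : ContDiff ℝ 2 Q := hWc.sub (q.contDiff.comp hVc)
  have hQd : ∀ z, fderiv ℝ Q z = fderiv ℝ W z - q.comp (fderiv ℝ V z) := by
    intro z
    have hVd : DifferentiableAt ℝ V z := hVc.differentiable (by norm_num) z
    have hWd : DifferentiableAt ℝ W z := hWc.differentiable (by norm_num) z
    exact (hWd.hasFDerivAt.sub (q.hasFDerivAt.comp z hVd.hasFDerivAt)).fderiv
  have hcomp : ∀ (L : Euc d →L[ℝ] Euc d) (t : ℝ), ‖L‖ ≤ t → ‖q.comp L‖ ≤ 6 * t := by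
    intro L t ht
    refine (q.opNorm_comp_le L).trans ?_
    gcongr
  have Q1 : ∀ z, |Q z| ≤ B2 + 6 * B1 := by
    intro z
    refine (abs_sub _ _).trans (add_le_add (W1 z) ?_)
    rw [← Real.norm_eq_abs]
    refine (q.le_opNorm _).trans ?_
    have := V1 z
    gcongr
  have Q2 : ∀ z, ‖fderiv ℝ Q z‖ ≤ B2 + 6 * B1 := by
    intro z
    rw [hQd]
    exact (norm_sub_le _ _).trans (add_le_add (W2 z) (hcomp _ _ (V2 z)))
  have Q3 : ∀ z z', ‖fderiv ℝ Q z - fderiv ℝ Q z'‖ ≤ (B2 + 6 * B1) * ‖z - z'‖ := by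
    intro z z'
    rw [hQd, hQd, sub_sub_sub_comm, ← ContinuousLinearMap.comp_sub]
    refine (norm_sub_le _ _).trans ((add_le_add (W3 z z') (hcomp _ _ (V3 z z'))).trans_eq ?_)
    ring
  set BB := B2 + 6 * B1 with hBB
  have hBB0 : 0 < BB := by positivity
  let R : Euc d → ℝ := fun x => M * h ^ 2 * (9 + Q (h⁻¹ • x - h⁻¹ • x₀))
  have hRd : ∀ x, fderiv ℝ R x = (M * h) • fderiv ℝ Q (h⁻¹ • x - h⁻¹ • x₀) := by
    intro x
    have h1 : HasFDerivAt (fun x : Euc d => h⁻¹ • x - h⁻¹ • x₀)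
        (h⁻¹ • ContinuousLinearMap.id ℝ (Euc d)) x :=
      ((hasFDerivAt_id x).const_smul h⁻¹).sub_const _
    have h2 : HasFDerivAt Q (fderiv ℝ Q (h⁻¹ • x - h⁻¹ • x₀)) (h⁻¹ • x - h⁻¹ • x₀) :=
      (hQc.differentiable (by norm_num) _).hasFDerivAt
    have h3 := ((h2.comp x h1).const_add 9).const_mul (M * h ^ 2)
    have h4 : fderiv ℝ R x = _ := h3.fderiv
    rw [h4]
    ext v
    simp
    field_simp
  refine ⟨R, ⟨?_, ?_, ?_, ?_⟩, ?_, ?_⟩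
  · have : ContDiff ℝ 1 Q := hQc.of_le (by norm_num)
    exact contDiff_const.mul (contDiff_const.add
      (this.comp ((contDiff_const_smul h⁻¹).sub contDiff_const)))
  · intro x
    have h1 := Q1 (h⁻¹ • x - h⁻¹ • x₀)
    have h2 : |9 + Q (h⁻¹ • x - h⁻¹ • x₀)| ≤ 9 + BB := by
      refine (abs_add_le _ _).trans ?_
      rw [abs_of_pos (by norm_num : (0 : ℝ) < 9)]
      linarith
    simp only [R]
    rw [abs_mul, abs_of_pos (by positivity)]
    calc M * h ^ 2 * _ ≤ M * h * (9 + BB) := by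
          have : M * h ^ 2 ≤ M * h := by nlinarith [mul_pos hMp hh]
          gcongr
      _ = _ := by rw [hBB]; ring
  · intro x
    rw [hRd, norm_smul, Real.norm_of_nonneg (by positivity)]
    have h1 := Q2 (h⁻¹ • x - h⁻¹ • x₀)
    calc M * h * _ ≤ M * h * (9 + BB) := by
          gcongr
          linarith
      _ = _ := by rw [hBB]; ring
  · intro x y _
    rw [hRd, hRd, ← smul_sub, norm_smul, Real.norm_of_nonneg (by positivity)]
    have h1 := Q3 (h⁻¹ • x - h⁻¹ • x₀) (h⁻¹ • y - h⁻¹ • x₀)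
    rw [sub_sub_sub_cancel_right, ← smul_sub h⁻¹ x y, norm_smul, norm_inv,
      Real.norm_of_nonneg hh.le] at h1
    calc M * h * _ ≤ M * h * (BB * (h⁻¹ * ‖x - y‖)) := by gcongr
      _ = BB * M * ‖x - y‖ := by field_simp
      _ ≤ (9 + B2 + 6 * B1) * M * ‖x - y‖ := by
        gcongr
        linarith
  · simp [R, Q, hV, hW, hχ0]
  · intro x
    have hz : h • (h⁻¹ • x - h⁻¹ • x₀) = x - x₀ := by
      rw [← smul_sub, smul_inv_smul₀ hh.ne']
    simp only [R, Q, hV, hW]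
    set z := h⁻¹ • x - h⁻¹ • x₀ with hzdef
    have hqz : M * h ^ 2 * q z = P (x - x₀) := by
      rw [← hz, hq]
      simp
      field_simp
    have hnz : ‖x - x₀‖ ^ 2 = h ^ 2 * ‖z‖ ^ 2 := by
      rw [← hz, norm_smul, Real.norm_of_nonneg hh.le, mul_pow]
    have h1 := (abs_le.1 (hT x₀ x)).1
    rw [hx₀, hnz, ← hqz] at h1
    have h2 := hmu x
    have c0 : 0 ≤ χ z := hχn z
    have c1 : χ z ≤ 1 := hχ1 z
    rw [map_smul, smul_eq_mul]
    have h3 : 0 ≤ (1 - χ z) * (u x + 9 * M * h ^ 2) :=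
      mul_nonneg (by linarith) (by linarith)
    have h4 : 0 ≤ χ z * (u x - M * h ^ 2 * q z + M * (h ^ 2 * ‖z‖ ^ 2)) :=
      mul_nonneg c0 (by linarith)
    nlinarith

/-- `C^{1,γ}` Whitney-type extension from an `(h,λ)`-net `G`: a linear
extension operator, the identity on `G`, bounded on `C^{1,γ}` uniformly in the net,
approximating `C²_b` functions to order `h^{1-γ}` in the `C^{1,γ}` norm, and almost order
preserving up to a corrector of size `h^{1-γ}`. -/
theorem whitney_extension_C1gamma (d : ℕ) (hd : 1 ≤ d) :
    ∃ h₀ : ℝ, 0 < h₀ ∧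
      ∀ γ lam : ℝ, γ ∈ Set.Ioo (0 : ℝ) 1 → lam ∈ Set.Ioc (0 : ℝ) 1 →
      ∃ C : ℝ, 0 < C ∧
        ∀ h : ℝ, h ∈ Set.Ioc (0 : ℝ) h₀ →
        ∀ G : Set (Euc d), IsNet h lam G →
        ∃ Ext : (G → ℝ) → (Euc d → ℝ),
          (∀ g₁ g₂ : G → ℝ, BddFun g₁ → BddFun g₂ → ∀ x,
            Ext (fun p => g₁ p + g₂ p) x = Ext g₁ x + Ext g₂ x) ∧
          (∀ (c : ℝ) (g : G → ℝ), BddFun g → ∀ x,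
            Ext (fun p => c * g p) x = c * Ext g x) ∧
          (∀ g : G → ℝ, BddFun g → ∀ p : G, Ext g p.1 = g p) ∧
          (∀ u : Euc d → ℝ, IsC1Holder γ u →
            IsC1Holder γ (Ext (fun p => u p.1)) ∧
            C1HolderNorm γ (Ext (fun p => u p.1)) ≤ C * C1HolderNorm γ u) ∧
          (∀ u : Euc d → ℝ, IsC2b u →
            IsC1Holder γ (fun x => Ext (fun p => u p.1) x - u x) ∧
            C1HolderNorm γ (fun x => Ext (fun p => u p.1) x - u x) ≤
              C * h ^ ((1 : ℝ) - γ) * C2Norm u) ∧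
          (∀ u : Euc d → ℝ, IsC3b u → (∀ p : G, 0 ≤ u p.1) →
            ∀ x₀ ∈ G, u x₀ = 0 →
            ∃ R : Euc d → ℝ, IsC1Holder γ R ∧ R x₀ = 0 ∧
              (∀ x, 0 ≤ Ext (fun p => u p.1) x + R x) ∧
              C1HolderNorm γ R ≤ C * h ^ ((1 : ℝ) - γ) * C3Norm u) := by
  obtain ⟨CR, hCR, hcorr⟩ := corrector d
  refine ⟨1, one_pos, fun γ lam hγ hlam => ?_⟩
  obtain ⟨K, ρ, hK, hρ, hcore⟩ := core d lam hlam.1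
  have hKρ : 0 < K * ρ := by positivity
  refine ⟨4 * (K * ρ + 1 + CR), by positivity, fun h hh G hG => ?_⟩
  obtain ⟨hh0, hh1⟩ := hh
  obtain ⟨hγ0, hγ1⟩ := hγ
  obtain ⟨Ext, hadd, hmul, hinterp, hest⟩ := hcore h hh0 G hG
  have hp0 : 0 ≤ h ^ (1 - γ) := Real.rpow_nonneg hh0.le _
  have hgood : ∀ u : Euc d → ℝ, IsC2b u →
      Good h ((K * ρ + 1) * C2Norm u) (fun x => Ext (fun p => u p.1) x - u x) := by
    intro u hu
    obtain ⟨n0, n1, n2⟩ := hu.bounds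
    have hu1 : ContDiff ℝ 1 u := hu.1.of_le (by norm_num)
    obtain ⟨e0, e1, e2, e3⟩ := hest u hu1 (C2Norm u * (ρ * h)) (by positivity) (fun x y hxy =>
      (n2 y x).trans (by gcongr))
    have hfd : ∀ x, fderiv ℝ (fun x => Ext (fun p => u p.1) x - u x) x
        = fderiv ℝ (Ext fun p => u p.1) x - fderiv ℝ u x := fun x =>
      fderiv_fun_sub (e0.differentiable (by norm_num) x) (hu1.differentiable (by norm_num) x)
    have hNh : 0 ≤ C2Norm u * h := by positivity
    have hKN : 0 ≤ K * ρ * (C2Norm u * h) := by positivity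
    refine ⟨e0.sub hu1, fun x => ?_, fun x => ?_, fun x y hxy => ?_⟩
    · refine (e1 x).trans ?_
      nlinarith [mul_le_mul_of_nonneg_left hh1 hKN]
    · rw [hfd]
      refine (e2 x).trans ?_
      nlinarith
    · rw [hfd, hfd, sub_sub_sub_comm]
      refine (norm_sub_le _ _).trans ((add_le_add (e3 y x hxy) (n2 x y)).trans_eq ?_)
      field_simp
  refine ⟨Ext, fun g₁ g₂ _ _ => hadd g₁ g₂, fun c g _ => hmul c g, fun g _ => hinterp g, ?_, ?_, ?_⟩
  · intro u hu
    obtain ⟨n0, n1, n2, n3⟩ := hu.bounds hγ0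
    set N := C1HolderNorm γ u with hN
    have hhγ : h ^ γ ≤ 1 := Real.rpow_le_one hh0.le hh1 hγ0.le
    have hhγ0 : 0 ≤ h ^ γ := Real.rpow_nonneg hh0.le _
    obtain ⟨e0, e1, e2, e3⟩ := hest u hu.1 (N * (ρ * h ^ γ)) (by positivity) (fun x y hxy => by
      refine (n3 y x).trans ?_
      have h1 : ‖y - x‖ ^ γ ≤ (ρ * h) ^ γ := by gcongr
      have h2 : (ρ * h) ^ γ = ρ ^ γ * h ^ γ := Real.mul_rpow (by linarith) hh0.le
      have h3 : ρ ^ γ ≤ ρ := by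
        have := Real.rpow_le_rpow_of_exponent_le hρ hγ1.le
        rwa [Real.rpow_one] at this
      have h4 : ρ ^ γ * h ^ γ ≤ ρ * h ^ γ := by gcongr
      gcongr
      linarith)
    have hKN : 0 ≤ K * ρ * N := by positivity
    have s1 : ∀ x, |Ext (fun p => u p.1) x| ≤ N + K * ρ * N := by
      intro x
      have h1 := abs_add_le (Ext (fun p => u p.1) x - u x) (u x)
      rw [sub_add_cancel] at h1
      have h2 : h ^ γ * h ≤ 1 := by nlinarith
      have h3 := mul_le_mul_of_nonneg_left h2 hKN
      nlinarith [e1 x, n1 x]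
    have s2 : ∀ x, ‖fderiv ℝ (Ext fun p => u p.1) x‖ ≤ N + K * ρ * N := by
      intro x
      have h1 := norm_add_le (fderiv ℝ (Ext fun p => u p.1) x - fderiv ℝ u x) (fderiv ℝ u x)
      rw [sub_add_cancel] at h1
      have h3 := mul_le_mul_of_nonneg_left hhγ hKN
      nlinarith [e2 x, n2 x]
    have s3 : ∀ x y, ‖fderiv ℝ (Ext fun p => u p.1) x - fderiv ℝ (Ext fun p => u p.1) y‖
        ≤ (2 * (K * ρ * N) + N) * ‖x - y‖ ^ γ := by
      intro x y
      rcases (norm_nonneg (x - y)).eq_or_lt with h0 | h0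
      · have : x = y := sub_eq_zero.1 (norm_eq_zero.1 h0.symm)
        subst this
        simp [Real.zero_rpow hγ0.ne']
      have hq0 : 0 ≤ ‖x - y‖ ^ γ := Real.rpow_nonneg h0.le _
      rcases le_total ‖x - y‖ h with h1 | h1
      · have h2 := e3 y x h1
        have h3 : h ^ γ * (‖x - y‖ / h) ≤ ‖x - y‖ ^ γ := by
          have h4 : ‖x - y‖ / h ≤ (‖x - y‖ / h) ^ γ := by
            have := Real.rpow_le_rpow_of_exponent_ge (div_pos h0 hh0) ((div_le_one hh0).2 h1) hγ1.le
            rwa [Real.rpow_one] at this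
          calc h ^ γ * (‖x - y‖ / h) ≤ h ^ γ * (‖x - y‖ / h) ^ γ := by gcongr
            _ = ‖x - y‖ ^ γ := by
              rw [← Real.mul_rpow hh0.le (by positivity)]
              congr 1
              field_simp
        have h4 := mul_le_mul_of_nonneg_left h3 hKN
        have h5 : 0 ≤ K * ρ * N * ‖x - y‖ ^ γ := by positivity
        have h6 : 0 ≤ N * ‖x - y‖ ^ γ := by positivity
        nlinarith
      · have h2 : h ^ γ ≤ ‖x - y‖ ^ γ := by gcongr
        have h3 := mul_le_mul_of_nonneg_left h2 hKN
        have h4 := norm_add_le (fderiv ℝ (Ext fun p => u p.1) x - fderiv ℝ u x)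
          ((fderiv ℝ u x - fderiv ℝ u y)
            - (fderiv ℝ (Ext fun p => u p.1) y - fderiv ℝ u y))
        have h5 := norm_sub_le (fderiv ℝ u x - fderiv ℝ u y)
          (fderiv ℝ (Ext fun p => u p.1) y - fderiv ℝ u y)
        have h6 : fderiv ℝ (Ext fun p => u p.1) x - fderiv ℝ u x +
          ((fderiv ℝ u x - fderiv ℝ u y) - (fderiv ℝ (Ext fun p => u p.1) y - fderiv ℝ u y))
          = fderiv ℝ (Ext fun p => u p.1) x - fderiv ℝ (Ext fun p => u p.1) y := by abel
        rw [h6] at h4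
        nlinarith [e2 x, e2 y, n3 x y]
    refine ⟨⟨e0, ⟨_, fun x => ⟨s1 x, s2 x⟩⟩, _, s3⟩, ?_⟩
    refine (C1HolderNorm_le s1 s2 (by positivity) s3).trans ?_
    have : 0 ≤ CR * N := by positivity
    nlinarith
  · intro u hu
    obtain ⟨g1, g2⟩ := (hgood u hu).norm hh0 hh1 hγ0 hγ1
    refine ⟨g1, g2.trans ?_⟩
    have n0 := hu.bounds.1
    have : 0 ≤ CR * (h ^ (1 - γ) * C2Norm u) := by positivity
    nlinarith
  · intro u hu hpos x₀ hx₀ hux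
    obtain ⟨hu2, hle⟩ := hu.c2
    obtain ⟨n0, n1, n2⟩ := hu2.bounds
    obtain ⟨R, r1, r2, r3⟩ := hcorr h lam G hh0 hh1 hG u (C2Norm u) (hu2.1.of_le (by norm_num))
      n0 n1 n2 hpos x₀ hux
    obtain ⟨g1, g2⟩ := (r1.sub (hgood u hu2)).norm hh0 hh1 hγ0 hγ1
    refine ⟨_, g1, ?_, fun x => ?_, g2.trans ?_⟩
    · have := hinterp (fun p => u p.1) ⟨x₀, hx₀⟩
      simp only at this
      simp only [this, r2]
      ring
    · have := r3 x
      linarith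
    · have h1 : C2Norm u * h ^ (1 - γ) ≤ C3Norm u * h ^ (1 - γ) := by gcongr
      have h2 : 0 ≤ 4 * (K * ρ + 1 + CR) := by positivity
      have h3 := mul_le_mul_of_nonneg_left h1 h2
      nlinarith

end
end
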